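/- Let (R, m) be a Noetherian local ring, N a finitely generated R-module of Krull dimension d, and I an ideal of R. Then Supp(H^{d-1}_I(N)) ⊆ Q̄*(I, N) ∪ {m}; consequently Ass_R H^{d-1}_I(N) is a finite set. -/

import Mathlib

open Pointwise

section Defs

variable {R : Type} [CommRing R]

/-- `x` is integrally dependent on the ideal `I` relative to the module `N`:
`x ^ n • N ⊆ ∑_{i=1}^n x^(n-i) • (I^i • N)` for some `n ≥ 1`. -/
def Ideal.RelIntDep (I : Ideal R) (N : Type) [AddCommGroup N] [Module R N] (x : R) : Prop :=
  ∃ n : ℕ, 0 < n ∧ ∀ m : N, x ^ n • m ∈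
    ⨆ i ∈ Finset.Icc 1 n, x ^ (n - i) • (I ^ i • (⊤ : Submodule R N))

/-- The integral closure `I^{(N)}_a` of `I` relative to `N`, as a subset of `R`. -/
def Ideal.relIntClosure (I : Ideal R) (N : Type) [AddCommGroup N] [Module R N] : Set R :=
  {x | I.RelIntDep N x}

/-- The classical integral closure `I_a` of an ideal, as a subset of `R`. -/
def Ideal.intClosure (I : Ideal R) : Set R :=
  {x | ∃ n : ℕ, 0 < n ∧ ∃ r : ℕ → R, (∀ i ∈ Finset.Icc 1 n, r i ∈ I ^ i) ∧
    x ^ n + ∑ i ∈ Finset.Icc 1 n, r i * x ^ (n - i) = 0}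

/-- `mAss_R N`: the set of minimal members of `Ass_R N`. -/
def mAss (R : Type) [CommRing R] (N : Type) [AddCommGroup N] [Module R N] : Set (Ideal R) :=
  {p | Minimal (· ∈ associatedPrimes R N) p}

/-- `Ass_R (R/J)` for a subset `J ⊆ R`: primes of the form `(J :_R x)`. -/
def assQuot (J : Set R) : Set (Ideal R) :=
  {p | p.IsPrime ∧ ∃ x : R, (p : Set R) = {r : R | r * x ∈ J}}

/-- `Ass_R (J/K)` for subsets `K ⊆ J` of `R`: primes of the form `(K :_R x)` with `x ∈ J`. -/
def assQuot₂ (J K : Set R) : Set (Ideal R) :=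
  {p | p.IsPrime ∧ ∃ x ∈ J, (p : Set R) = {r : R | r * x ∈ K}}

/-- `S(J) = ∪_{s ∈ S} (J :_R s)`. -/
def sat (S : Set R) (J : Set R) : Set R := {x | ∃ s ∈ S, s * x ∈ J}

/-- `(J :_R K)` for subsets of `R`. -/
def setColon (J K : Set R) : Set R := {x | ∀ y ∈ K, x * y ∈ J}

/-- `(J :_R ⟨K⟩) = ∪_{n ≥ 1} (J :_R K^n)`. -/
def colonPow (J : Set R) (K : Ideal R) : Set R :=
  {x | ∃ n : ℕ, 0 < n ∧ ∀ y ∈ K ^ n, x * y ∈ J}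

end Defs
section Quint

variable {R : Type} [CommRing R]

/-- Auxiliary: the quintasymptotic condition at a prime `p`: there is a minimal associated
prime `q` of the completion `N̂ₚ` of `Nₚ` over the completion `R̂ₚ` of `Rₚ` with
`Rad(I·R̂ₚ + q) = p·R̂ₚ`. -/
def Ideal.quintAux (I p : Ideal R) (N : Type) [AddCommGroup N] [Module R N] [p.IsPrime] : Prop :=
  ∃ q : Ideal (AdicCompletion (IsLocalRing.maximalIdeal (Localization.AtPrime p))
      (Localization.AtPrime p)),
    q ∈ mAss (AdicCompletion (IsLocalRing.maximalIdeal (Localization.AtPrime p))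
        (Localization.AtPrime p))
      (AdicCompletion (IsLocalRing.maximalIdeal (Localization.AtPrime p))
        (LocalizedModule p.primeCompl N)) ∧
    (I.map ((algebraMap (Localization.AtPrime p)
        (AdicCompletion (IsLocalRing.maximalIdeal (Localization.AtPrime p))
          (Localization.AtPrime p))).comp (algebraMap R (Localization.AtPrime p))) ⊔ q).radical =
      p.map ((algebraMap (Localization.AtPrime p)
        (AdicCompletion (IsLocalRing.maximalIdeal (Localization.AtPrime p))
          (Localization.AtPrime p))).comp (algebraMap R (Localization.AtPrime p)))

/-- `p ∈ Q̄*(I, N)`: `p` is a quintasymptotic prime of `I` with respect to `N`. -/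
def Ideal.IsQuintasymptotic (I p : Ideal R) (N : Type) [AddCommGroup N] [Module R N] : Prop :=
  ∃ hp : p.IsPrime, @Ideal.quintAux R _ I p N _ _ hp

end Quint

namespace ExtComparison

open CategoryTheory CategoryTheory.Limits Opposite CategoryTheory.Abelian

variable {R : Type} [CommRing R] {X Y : ModuleCat.{0} R} (P : ProjectiveResolution X)

/-- The complex `Hom(P, Y)`, as a complex in the opposite category of modules. -/
noncomputable abbrev homComplex (Y : ModuleCat.{0} R) : ChainComplex (ModuleCat.{0} R)ᵒᵖ ℕ :=
  (((linearYoneda R (ModuleCat.{0} R)).obj Y).rightOp.mapHomologicalComplex _).obj P.complex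

/-- The morphism `Hom(P_n, Y) ⟶ R` of the opposite category given by an element of `Hom(P_n, Y)`. -/
noncomputable def point {n : ℕ} (f : P.complex.X n ⟶ Y) :
    (homComplex P Y).X n ⟶ op (ModuleCat.of R R) :=
  (ModuleCat.ofHom (LinearMap.toSpanSingleton R (P.complex.X n ⟶ Y) f)).op

lemma d_point {n m : ℕ} (f : P.complex.X n ⟶ Y) :
    (homComplex P Y).d m n ≫ point P f = point P (P.complex.d m n ≫ f) := by
  apply Quiver.Hom.unop_inj
  apply ModuleCat.hom_ext
  ext
  rfl

lemma point_add {n : ℕ} (f g : P.complex.X n ⟶ Y) : point P (f + g) = point P f + point P g := by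
  apply Quiver.Hom.unop_inj
  apply ModuleCat.hom_ext
  refine LinearMap.ext_ring ?_
  show (1 : R) • (f + g) = (1 : R) • f + (1 : R) • g
  exact smul_add _ _ _

lemma point_surjective {n : ℕ} (h : (homComplex P Y).X n ⟶ op (ModuleCat.of R R)) :
    ∃ f, point P f = h := by
  refine ⟨h.unop.hom (1 : R), ?_⟩
  apply Quiver.Hom.unop_inj
  apply ModuleCat.hom_ext
  refine LinearMap.ext_ring ?_
  exact one_smul R _

lemma point_zero {n : ℕ} : point P (0 : P.complex.X n ⟶ Y) = 0 := by
  simpa using (point_add P (0 : P.complex.X n ⟶ Y) 0)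

lemma point_injective {n : ℕ} : Function.Injective (point P (Y := Y) (n := n)) := by
  intro f g h
  have := congrArg (fun k => k.unop.hom (1 : R)) h
  have h2 : (1 : R) • f = (1 : R) • g := this
  simpa using h2

/-- The morphism to `R` in the opposite category given by a cocycle of `Hom(P, Y)`. -/
noncomputable def classHom {n : ℕ} (f : P.complex.X n ⟶ Y)
    (hf : P.complex.d (n + 1) n ≫ f = 0) :
    (homComplex P Y).homology n ⟶ op (ModuleCat.of R R) :=
  (homComplex P Y).homologyι n ≫ (homComplex P Y).descOpcycles (point P f) (n + 1) (by simp)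
    (by rw [d_point, hf, point_zero])

instance : Injective (op (ModuleCat.of R R)) := by
  have : Projective (ModuleCat.of R R) := (IsProjective.iff_projective R).1 inferInstance
  infer_instance

lemma classHom_surjective {n : ℕ} (h : (homComplex P Y).homology n ⟶ op (ModuleCat.of R R)) :
    ∃ f hf, classHom P (Y := Y) (n := n) f hf = h := by
  obtain ⟨f, hf⟩ := point_surjective P
    ((homComplex P Y).pOpcycles n ≫ Injective.factorThru h ((homComplex P Y).homologyι n))
  refine ⟨f, ?_, ?_⟩
  · apply point_injective
    rw [← d_point, hf, point_zero, HomologicalComplex.d_pOpcycles_assoc, zero_comp]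
  · rw [classHom]
    have : (homComplex P Y).descOpcycles (point P f) (n + 1) (by simp)
        (by rw [hf, HomologicalComplex.d_pOpcycles_assoc, zero_comp]) =
      Injective.factorThru h ((homComplex P Y).homologyι n) := by
      rw [← cancel_epi ((homComplex P Y).pOpcycles n), HomologicalComplex.p_descOpcycles, hf]
    rw [this]
    simp

lemma classHom_eq_zero_iff {n : ℕ} (f : P.complex.X n ⟶ Y)
    (hf : P.complex.d (n + 1) n ≫ f = 0) (p : ℕ) (hp : (ComplexShape.down ℕ).next n = p) :
    classHom P f hf = 0 ↔ ∃ g : P.complex.X p ⟶ Y, f = P.complex.d n p ≫ g := by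
  constructor
  · intro h
    let S : ShortComplex (ModuleCat.{0} R)ᵒᵖ := ShortComplex.mk ((homComplex P Y).homologyι n)
      ((homComplex P Y).fromOpcycles n p) ((homComplex P Y).homologyι_comp_fromOpcycles n p)
    have hS : S.Exact := S.exact_of_f_is_kernel ((homComplex P Y).homologyIsKernel n p hp)
    obtain ⟨g, hg⟩ := point_surjective P (hS.descToInjective _ h)
    refine ⟨g, point_injective P ?_⟩
    have h2 := hS.comp_descToInjective _ h
    rw [← hg] at h2
    have h3 := congrArg (fun k => (homComplex P Y).pOpcycles n ≫ k) h2
    simp only [S] at h3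
    rw [HomologicalComplex.p_fromOpcycles_assoc, HomologicalComplex.p_descOpcycles] at h3
    rw [← h3, ← d_point]
  · rintro ⟨g, rfl⟩
    exact (homComplex P Y).homologyι_descOpcycles_eq_zero_of_boundary _ (n + 1) (by simp)
      (i' := p) (point P g) (d_point P g).symm

/-- The element of `Ext^n(X, Y)` whose associated morphism in the opposite category is given. -/
noncomputable def ofHomUnop {n : ℕ}
    (h : (((linearYoneda R (ModuleCat.{0} R)).obj Y).rightOp.leftDerived n).obj X ⟶
      op (ModuleCat.of R R)) :
    ((_root_.Ext R (ModuleCat.{0} R) n).obj (op X)).obj Y :=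
  h.unop.hom (1 : R)

lemma ofHomUnop_bijective {n : ℕ} : Function.Bijective (ofHomUnop (X := X) (Y := Y) (n := n)) := by
  constructor
  · intro a b h
    apply Quiver.Hom.unop_inj
    apply ModuleCat.hom_ext
    exact LinearMap.ext_ring h
  · intro x
    refine ⟨(ModuleCat.ofHom (LinearMap.toSpanSingleton R
      (((_root_.Ext R (ModuleCat.{0} R) n).obj (op X)).obj Y) x)).op, ?_⟩
    exact one_smul R x

/-- The left derived functor of `Hom(-, Y)` computed by a projective resolution. -/
noncomputable def isoHomology (n : ℕ) (Y : ModuleCat.{0} R) :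
    (((linearYoneda R (ModuleCat.{0} R)).obj Y).rightOp.leftDerived n).obj X ≅
      (homComplex P Y).homology n :=
  P.isoLeftDerivedObj _ n

lemma leftDerived_app_isoHomology {Y' : ModuleCat.{0} R} (n : ℕ) (g : Y ⟶ Y') :
    (NatTrans.leftDerived (((linearYoneda R (ModuleCat.{0} R)).map g).rightOp) n).app X ≫
      (isoHomology P n Y).hom = (isoHomology P n Y').hom ≫ HomologicalComplex.homologyMap
        ((NatTrans.mapHomologicalComplex (((linearYoneda R (ModuleCat.{0} R)).map g).rightOp)
          _).app P.complex) n := by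
  rw [← Iso.eq_comp_inv, Category.assoc]
  exact P.leftDerived_app_eq (((linearYoneda R (ModuleCat.{0} R)).map g).rightOp) n

lemma leftDerived_map_isoHomology {X' : ModuleCat.{0} R} {P' : ProjectiveResolution X'} (n : ℕ)
    {a : X' ⟶ X} (φ : P'.complex ⟶ P.complex)
    (w : φ ≫ P.π = P'.π ≫ (ChainComplex.single₀ _).map a) :
    (((linearYoneda R (ModuleCat.{0} R)).obj Y).rightOp.leftDerived n).map a ≫
      (isoHomology P n Y).hom = (isoHomology P' n Y).hom ≫ HomologicalComplex.homologyMap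
        (((((linearYoneda R (ModuleCat.{0} R)).obj Y).rightOp).mapHomologicalComplex _).map φ)
          n := by
  rw [← Iso.eq_comp_inv, Category.assoc]
  exact (((linearYoneda R (ModuleCat.{0} R)).obj Y).rightOp).leftDerived_map_eq n a φ w

/-- The class in `Ext^n(X, Y)` of a cocycle of `Hom(P, Y)`. -/
noncomputable def mk {n : ℕ} (f : P.complex.X n ⟶ Y) (hf : P.complex.d (n + 1) n ≫ f = 0) :
    ((_root_.Ext R (ModuleCat.{0} R) n).obj (op X)).obj Y :=
  ofHomUnop ((isoHomology P n Y).hom ≫ classHom P f hf)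

lemma classHom_add {n : ℕ} (f g : P.complex.X n ⟶ Y)
    (hf : P.complex.d (n + 1) n ≫ f = 0) (hg : P.complex.d (n + 1) n ≫ g = 0)
    (hfg : P.complex.d (n + 1) n ≫ (f + g) = 0) :
    classHom P (f + g) hfg = classHom P f hf + classHom P g hg := by
  simp only [classHom]
  refine Eq.trans ?_ (Preadditive.comp_add _ _ _ _ _ _)
  congr 1
  rw [← cancel_epi ((homComplex P Y).pOpcycles n), Preadditive.comp_add]
  simp only [HomologicalComplex.p_descOpcycles, point_add]

lemma mk_add {n : ℕ} (f g : P.complex.X n ⟶ Y)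
    (hf : P.complex.d (n + 1) n ≫ f = 0) (hg : P.complex.d (n + 1) n ≫ g = 0)
    (hfg : P.complex.d (n + 1) n ≫ (f + g) = 0) :
    mk P (f + g) hfg = mk P f hf + mk P g hg := by
  rw [mk, classHom_add P f g hf hg, Preadditive.comp_add]
  rfl

lemma mk_surjective {n : ℕ} (x : ((_root_.Ext R (ModuleCat.{0} R) n).obj (op X)).obj Y) :
    ∃ f hf, mk P (Y := Y) (n := n) f hf = x := by
  obtain ⟨h, rfl⟩ := ofHomUnop_bijective.2 x
  obtain ⟨f, hf, h2⟩ := classHom_surjective P ((isoHomology P n Y).inv ≫ h)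
  exact ⟨f, hf, by rw [mk, h2, Iso.hom_inv_id_assoc]⟩

lemma mk_eq_zero_iff {n : ℕ} (f : P.complex.X n ⟶ Y)
    (hf : P.complex.d (n + 1) n ≫ f = 0) (p : ℕ) (hp : (ComplexShape.down ℕ).next n = p) :
    mk P f hf = 0 ↔ ∃ g : P.complex.X p ⟶ Y, f = P.complex.d n p ≫ g := by
  rw [← classHom_eq_zero_iff P f hf p hp]
  have h0 : (0 : ((_root_.Ext R (ModuleCat.{0} R) n).obj (op X)).obj Y) = ofHomUnop 0 := rfl
  rw [mk, h0, ofHomUnop_bijective.1.eq_iff]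
  constructor
  · intro h
    rw [← cancel_epi (isoHomology P n Y).hom, h, comp_zero]
  · intro h
    rw [h, comp_zero]

lemma map_mk {Y' : ModuleCat.{0} R} {n : ℕ} (f : P.complex.X n ⟶ Y)
    (hf : P.complex.d (n + 1) n ≫ f = 0) (g : Y ⟶ Y') :
    ((_root_.Ext R (ModuleCat.{0} R) n).obj (op X)).map g (mk P f hf) =
      mk P (f ≫ g) (by rw [reassoc_of% hf, zero_comp]) := by
  change ofHomUnop ((NatTrans.leftDerived (((linearYoneda R (ModuleCat.{0} R)).map g).rightOp)
    n).app X ≫ (isoHomology P n Y).hom ≫ classHom P f hf) = _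
  rw [reassoc_of% (leftDerived_app_isoHomology P n g), mk, classHom,
    HomologicalComplex.homologyι_naturality_assoc, HomologicalComplex.opcyclesMap_comp_descOpcycles]
  have h : ((NatTrans.mapHomologicalComplex (((linearYoneda R (ModuleCat.{0} R)).map g).rightOp)
      (ComplexShape.down ℕ)).app P.complex).f n ≫ point P f = point P (f ≫ g) := by
    apply Quiver.Hom.unop_inj
    apply ModuleCat.hom_ext
    refine LinearMap.ext_ring ?_
    show ((1 : R) • f) ≫ g = (1 : R) • (f ≫ g)
    simp
  congr 2
  simp only [h]
  rfl

lemma map_app_mk {X' : ModuleCat.{0} R} {P' : ProjectiveResolution X'} {n : ℕ}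
    (f : P.complex.X n ⟶ Y)
    (hf : P.complex.d (n + 1) n ≫ f = 0) {a : X' ⟶ X} (φ : P'.complex ⟶ P.complex)
    (w : φ ≫ P.π = P'.π ≫ (ChainComplex.single₀ _).map a) :
    ((_root_.Ext R (ModuleCat.{0} R) n).map a.op).app Y (mk P f hf) =
      mk P' (φ.f n ≫ f) (by rw [← φ.comm_assoc, hf, comp_zero]) := by
  change ofHomUnop ((((linearYoneda R (ModuleCat.{0} R)).obj Y).rightOp.leftDerived n).map a ≫
    (isoHomology P n Y).hom ≫ classHom P f hf) = _
  rw [reassoc_of% (leftDerived_map_isoHomology P (Y := Y) n φ w), mk, classHom,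
    HomologicalComplex.homologyι_naturality_assoc, HomologicalComplex.opcyclesMap_comp_descOpcycles]
  congr 3

instance : HasExt.{0} (ModuleCat.{0} R) := hasExt_of_enoughProjectives _

lemma extMk_eq_zero_iff_mk_eq_zero {n : ℕ} (f : P.complex.X n ⟶ Y)
    (hf : P.complex.d (n + 1) n ≫ f = 0) :
    P.extMk f (n + 1) rfl hf = 0 ↔ mk P f hf = 0 := by
  rcases n with - | n
  · rw [mk_eq_zero_iff P f hf 0 (by simp)]
    simp only [← P.extEquivCohomologyClass.apply_eq_iff_eq,
      ProjectiveResolution.extEquivCohomologyClass_extMk,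
      ProjectiveResolution.extEquivCohomologyClass_zero,
      CochainComplex.HomComplex.CohomologyClass.mk_eq_zero_iff]
    rw [CochainComplex.HomComplex.Cocycle.toSingleMk_mem_coboundaries_iff _ _ _ _ _ 1 (by lia)]
    have h0 : IsZero (P.cochainComplex.X 1) :=
      HomologicalComplex.isZero_extend_X _ _ _ (by
        intro i hi
        have hi' : -(i : ℤ) = 1 := hi
        lia)
    constructor
    · rintro ⟨g, hg⟩
      refine ⟨0, ?_⟩
      rw [h0.eq_of_src g 0, comp_zero] at hg
      rw [comp_zero, ← cancel_epi (P.cochainComplexXIso (-(0 : ℕ)) 0 rfl).hom, ← hg, comp_zero]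
    · rintro ⟨g, rfl⟩
      refine ⟨0, ?_⟩
      rw [comp_zero, P.complex.shape 0 0 (by simp), zero_comp, comp_zero]
  · rw [mk_eq_zero_iff P f hf n (by simp), P.extMk_eq_zero_iff f _ rfl hf n rfl]
    simp only [eq_comm]

lemma mk_sub {n : ℕ} (f g : P.complex.X n ⟶ Y)
    (hf : P.complex.d (n + 1) n ≫ f = 0) (hg : P.complex.d (n + 1) n ≫ g = 0)
    (hfg : P.complex.d (n + 1) n ≫ (f - g) = 0) :
    mk P (f - g) hfg = mk P f hf - mk P g hg := by
  rw [eq_sub_iff_add_eq, ← mk_add P _ _ _ _ (by simp [hf])]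
  simp

lemma mk_eq_mk_iff {n : ℕ} (f g : P.complex.X n ⟶ Y)
    (hf : P.complex.d (n + 1) n ≫ f = 0) (hg : P.complex.d (n + 1) n ≫ g = 0) :
    mk P f hf = mk P g hg ↔ P.extMk f (n + 1) rfl hf = P.extMk g (n + 1) rfl hg := by
  rw [← sub_eq_zero, ← mk_sub P _ _ _ _ (by simp [hf, hg]), ← sub_eq_zero (b := P.extMk g _ _ _),
    P.sub_extMk, extMk_eq_zero_iff_mk_eq_zero]

/-- The map from the `Ext`-groups defined by the derived category to
those defined by left derived functors. -/
noncomputable def comparison {n : ℕ} (x : Abelian.Ext.{0} X Y n) :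
    ((_root_.Ext R (ModuleCat.{0} R) n).obj (op X)).obj Y :=
  mk (projectiveResolution X) ((projectiveResolution X).extMk_surjective x (n + 1) rfl).choose
    ((projectiveResolution X).extMk_surjective x (n + 1) rfl).choose_spec.choose

lemma comparison_extMk {n : ℕ} (f : (projectiveResolution X).complex.X n ⟶ Y)
    (hf : (projectiveResolution X).complex.d (n + 1) n ≫ f = 0) :
    comparison ((projectiveResolution X).extMk f (n + 1) rfl hf) =
      mk (projectiveResolution X) f hf := by
  rw [comparison, mk_eq_mk_iff]
  exact ((projectiveResolution X).extMk_surjective _ (n + 1) rfl).choose_spec.choose_spec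

lemma comparison_bijective (X Y : ModuleCat.{0} R) (n : ℕ) :
    Function.Bijective (comparison (X := X) (Y := Y) (n := n)) := by
  constructor
  · intro x y h
    obtain ⟨f, hf, rfl⟩ := (projectiveResolution X).extMk_surjective x (n + 1) rfl
    obtain ⟨g, hg, rfl⟩ := (projectiveResolution X).extMk_surjective y (n + 1) rfl
    rwa [comparison_extMk, comparison_extMk, mk_eq_mk_iff] at h
  · intro x
    obtain ⟨f, hf, rfl⟩ := mk_surjective (projectiveResolution X) x
    exact ⟨_, comparison_extMk f hf⟩

lemma comparison_add {n : ℕ} (x y : Abelian.Ext.{0} X Y n) :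
    comparison (x + y) = comparison x + comparison y := by
  obtain ⟨f, hf, rfl⟩ := (projectiveResolution X).extMk_surjective x (n + 1) rfl
  obtain ⟨g, hg, rfl⟩ := (projectiveResolution X).extMk_surjective y (n + 1) rfl
  rw [ProjectiveResolution.add_extMk, comparison_extMk, comparison_extMk, comparison_extMk,
    mk_add]

lemma map_comparison {Y' : ModuleCat.{0} R} {n : ℕ} (x : Abelian.Ext.{0} X Y n) (g : Y ⟶ Y') :
    ((_root_.Ext R (ModuleCat.{0} R) n).obj (op X)).map g (comparison x) =
      comparison (x.comp (Abelian.Ext.mk₀ g) (add_zero _)) := by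
  obtain ⟨f, hf, rfl⟩ := (projectiveResolution X).extMk_surjective x (n + 1) rfl
  rw [ProjectiveResolution.extMk_comp_mk₀, comparison_extMk, comparison_extMk, map_mk]

lemma map_app_comparison {X' : ModuleCat.{0} R} {n : ℕ} (x : Abelian.Ext.{0} X Y n)
    (a : X' ⟶ X) :
    ((_root_.Ext R (ModuleCat.{0} R) n).map a.op).app Y (comparison x) =
      comparison ((Abelian.Ext.mk₀ a).comp x (zero_add _)) := by
  obtain ⟨f, hf, rfl⟩ := (projectiveResolution X).extMk_surjective x (n + 1) rfl
  rw [ProjectiveResolution.mk₀_comp_extMk f _ rfl hf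
    (R' := projectiveResolution X') ⟨ProjectiveResolution.lift a _ _, by
      simpa using ProjectiveResolution.lift_commutes_zero a _ _⟩,
    comparison_extMk, comparison_extMk,
    map_app_mk _ _ _ _ (ProjectiveResolution.lift_commutes _ _ _)]

lemma smul_mk {n : ℕ} (r : R) (f : P.complex.X n ⟶ Y)
    (hf : P.complex.d (n + 1) n ≫ f = 0) (hrf : P.complex.d (n + 1) n ≫ (r • f) = 0) :
    r • mk P f hf = mk P (r • f) hrf := by
  have h1 : point P (r • f) = point P f ≫ (ModuleCat.ofHom (LinearMap.lsmul R R r)).op := by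
    apply Quiver.Hom.unop_inj
    apply ModuleCat.hom_ext
    refine LinearMap.ext_ring ?_
    show (1 : R) • r • f = (r • (1 : R)) • f
    simp
  have h2 : classHom P (r • f) hrf = classHom P f hf ≫
      (ModuleCat.ofHom (LinearMap.lsmul R R r)).op := by
    rw [classHom, classHom, Category.assoc, HomologicalComplex.descOpcycles_comp]
    simp only [h1]
  rw [mk, mk, h2]
  let u : R →ₗ[R] ((_root_.Ext R (ModuleCat.{0} R) n).obj (op X)).obj Y :=
    ((isoHomology P n Y).hom ≫ classHom P f hf).unop.hom
  change r • u (1 : R) = u (r • (1 : R))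
  rw [map_smul]

lemma comparison_smul {n : ℕ} (r : R) (x : Abelian.Ext.{0} X Y n) :
    comparison (x.comp (Abelian.Ext.mk₀ (r • 𝟙 Y)) (add_zero _)) = r • comparison x := by
  obtain ⟨f, hf, rfl⟩ := (projectiveResolution X).extMk_surjective x (n + 1) rfl
  rw [ProjectiveResolution.extMk_comp_mk₀, comparison_extMk, comparison_extMk, smul_mk]
  · congr 1
  · rw [Linear.comp_smul, hf, smul_zero]

end ExtComparison

namespace LocalCohomologyAux

open CategoryTheory CategoryTheory.Limits Opposite CategoryTheory.Abelian localCohomology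

variable {R : Type} [CommRing R] (I : Ideal R)

/-- The module `R / I ^ n`. -/
noncomputable abbrev quot (n : ℕ) : ModuleCat.{0} R :=
  (ringModIdeals (idealPowersDiagram I)).obj (op n)

/-- The projection `R / I ^ m ⟶ R / I ^ n`. -/
noncomputable abbrev proj {n m : ℕ} (h : n ≤ m) : quot I m ⟶ quot I n :=
  (ringModIdeals (idealPowersDiagram I)).map (homOfLE h).op

/-- The cocone exhibiting local cohomology as a colimit of `Ext` modules. -/
noncomputable def cocone (i : ℕ) (M : ModuleCat.{0} R) :
    Cocone (diagram (idealPowersDiagram I) i ⋙ (evaluation _ _).obj M) :=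
  ((evaluation _ _).obj M).mapCocone (colimit.cocone (diagram (idealPowersDiagram I) i))

/-- The cocone `cocone I i M` is a colimit cocone. -/
noncomputable def isColimitCocone (i : ℕ) (M : ModuleCat.{0} R) : IsColimit (cocone I i M) :=
  isColimitOfPreserves ((evaluation _ _).obj M)
    (colimit.isColimit (diagram (idealPowersDiagram I) i))

/-- The structure map `Ext^i(R / I ^ n, M) → H^i_I(M)`. -/
noncomputable def ι (n : ℕ) {i : ℕ} {M : ModuleCat.{0} R} (e : Abelian.Ext.{0} (quot I n) M i) :
    (localCohomology I i).obj M :=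
  (cocone I i M).ι.app (op (op n)) (ExtComparison.comparison e)

variable {I}

lemma ι_surjective {i : ℕ} {M : ModuleCat.{0} R} (x : (localCohomology I i).obj M) :
    ∃ (n : ℕ) (e : Abelian.Ext.{0} (quot I n) M i), ι I n e = x := by
  obtain ⟨⟨⟨n⟩⟩, y, hy⟩ := Concrete.isColimit_exists_rep _ (isColimitCocone I i M) x
  obtain ⟨e, rfl⟩ := (ExtComparison.comparison_bijective _ _ _).2 y
  exact ⟨n, e, hy⟩

lemma ι_proj {i n m : ℕ} {M : ModuleCat.{0} R} (h : n ≤ m) (e : Abelian.Ext.{0} (quot I n) M i) :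
    ι I m ((Abelian.Ext.mk₀ (proj I h)).comp e (zero_add _)) = ι I n e := by
  rw [ι, ← ExtComparison.map_app_comparison]
  exact ConcreteCategory.congr_hom ((cocone I i M).ι.naturality
    (X := op (op n)) (Y := op (op m)) (homOfLE h).op.op) (ExtComparison.comparison e)

lemma ι_add {i n : ℕ} {M : ModuleCat.{0} R} (x y : Abelian.Ext.{0} (quot I n) M i) :
    ι I n (x + y) = ι I n x + ι I n y := by
  rw [ι, ExtComparison.comparison_add]
  exact map_add ((cocone I i M).ι.app (op (op n))).hom _ _

lemma ι_zero {i n : ℕ} {M : ModuleCat.{0} R} :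
    ι I n (0 : Abelian.Ext.{0} (quot I n) M i) = 0 := by
  have := ι_add (0 : Abelian.Ext.{0} (quot I n) M i) 0
  simpa using this

lemma ι_sub {i n : ℕ} {M : ModuleCat.{0} R} (x y : Abelian.Ext.{0} (quot I n) M i) :
    ι I n (x - y) = ι I n x - ι I n y := by
  rw [eq_sub_iff_add_eq, ← ι_add, sub_add_cancel]

lemma ι_smul {i n : ℕ} {M : ModuleCat.{0} R} (r : R) (x : Abelian.Ext.{0} (quot I n) M i) :
    ι I n (x.comp (Abelian.Ext.mk₀ (r • 𝟙 M)) (add_zero _)) = r • ι I n x := by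
  rw [ι, ExtComparison.comparison_smul]
  exact map_smul ((cocone I i M).ι.app (op (op n))).hom _ _

lemma map_ι {i n : ℕ} {M N : ModuleCat.{0} R} (f : M ⟶ N) (x : Abelian.Ext.{0} (quot I n) M i) :
    (localCohomology I i).map f (ι I n x) =
      ι I n (x.comp (Abelian.Ext.mk₀ f) (add_zero _)) := by
  refine Eq.trans ?_ (congrArg (fun y ↦ (cocone I i N).ι.app (op (op n)) y)
    (ExtComparison.map_comparison x f))
  exact (ConcreteCategory.congr_hom
    ((colimit.ι (diagram (idealPowersDiagram I) i) (op (op n))).naturality f)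
    (ExtComparison.comparison x)).symm

lemma ι_eq_zero {i n : ℕ} {M : ModuleCat.{0} R} {e : Abelian.Ext.{0} (quot I n) M i}
    (he : ι I n e = 0) :
    ∃ (m : ℕ) (h : n ≤ m), (Abelian.Ext.mk₀ (proj I h)).comp e (zero_add _) = 0 := by
  rw [← ι_zero (n := n)] at he
  obtain ⟨⟨⟨m⟩⟩, f, g, h⟩ :=
    (Concrete.isColimit_rep_eq_iff_exists _ (isColimitCocone I i M) _ _).1 he
  refine ⟨m, leOfHom f.unop.unop, ?_⟩
  have hfg : f = g := Subsingleton.elim _ _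
  subst hfg
  apply (ExtComparison.comparison_bijective _ _ _).1
  have h0 : ExtComparison.comparison (0 : Abelian.Ext.{0} (quot I m) M i) =
    ExtComparison.comparison ((Abelian.Ext.mk₀ (proj I (leOfHom f.unop.unop))).comp
      (0 : Abelian.Ext.{0} (quot I n) M i) (zero_add _)) := by simp
  rw [h0, ← ExtComparison.map_app_comparison, ← ExtComparison.map_app_comparison]
  exact h

end LocalCohomologyAux

namespace LocalCohomologyAux

open CategoryTheory CategoryTheory.Limits Opposite CategoryTheory.Abelian localCohomology

section

variable {R : Type} [CommRing R] {I : Ideal R}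

lemma proj_comp_eq_zero {i j k n m : ℕ} {M N : ModuleCat.{0} R} (h : n ≤ m)
    (e : Abelian.Ext.{0} (quot I n) M i) (β : Abelian.Ext.{0} M N j) (hk : i + j = k)
    (he : (Abelian.Ext.mk₀ (proj I h)).comp e (zero_add _) = 0) :
    (Abelian.Ext.mk₀ (proj I h)).comp (e.comp β hk) (zero_add _) = 0 := by
  rw [← Abelian.Ext.comp_assoc _ _ _ (zero_add i) hk (by lia), he, Abelian.Ext.zero_comp]

/-- Two classes given at a common level. -/
lemma exists_common_level {i : ℕ} {M : ModuleCat.{0} R} (x y : (localCohomology I i).obj M) :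
    ∃ (n : ℕ) (e f : Abelian.Ext.{0} (quot I n) M i), ι I n e = x ∧ ι I n f = y := by
  obtain ⟨n, e, rfl⟩ := ι_surjective x
  obtain ⟨m, f, rfl⟩ := ι_surjective y
  exact ⟨max n m, _, _, ι_proj (le_max_left n m) e, ι_proj (le_max_right n m) f⟩

lemma ι_comp_congr {i j k n n' : ℕ} {M N : ModuleCat.{0} R}
    (e : Abelian.Ext.{0} (quot I n) M i) (e' : Abelian.Ext.{0} (quot I n') M i)
    (β : Abelian.Ext.{0} M N j) (hk : i + j = k) (h : ι I n e = ι I n' e') :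
    ι I n (e.comp β hk) = ι I n' (e'.comp β hk) := by
  rw [← ι_proj (le_max_left n n') (e.comp β hk), ← ι_proj (le_max_right n n') (e'.comp β hk),
    ← Abelian.Ext.comp_assoc _ _ _ (zero_add i) hk (by lia),
    ← Abelian.Ext.comp_assoc _ _ _ (zero_add i) hk (by lia)]
  rw [← ι_proj (le_max_left n n') e, ← ι_proj (le_max_right n n') e', ← sub_eq_zero,
    ← ι_sub] at h
  obtain ⟨m, hm, h0⟩ := ι_eq_zero h
  have := proj_comp_eq_zero hm _ β hk h0
  rw [← sub_eq_zero, ← ι_sub, ← ι_proj hm, ← Abelian.Ext.bilinearComp_apply_apply]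
  simp only [Abelian.Ext.bilinearComp_apply_apply]
  rw [← ι_zero (n := m), ← this]
  congr 2
  simp [sub_eq_add_neg]

/-- The map on local cohomology induced by an `Ext` class. -/
noncomputable def compExt {i j k : ℕ} {M N : ModuleCat.{0} R}
    (β : Abelian.Ext.{0} M N j) (hk : i + j = k) :
    (localCohomology I i).obj M →ₗ[R] (localCohomology I k).obj N where
  toFun x := ι I _ ((ι_surjective x).choose_spec.choose.comp β hk)
  map_add' x y := by
    obtain ⟨n, e, f, rfl, rfl⟩ := exists_common_level x y
    rw [ι_comp_congr _ (e + f) β hk (by rw [Exists.choose_spec (ι_surjective _).choose_spec,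
        ι_add]),
      ι_comp_congr _ e β hk (Exists.choose_spec (ι_surjective _).choose_spec),
      ι_comp_congr _ f β hk (Exists.choose_spec (ι_surjective _).choose_spec),
      Abelian.Ext.add_comp, ι_add]
  map_smul' r x := by
    obtain ⟨n, e, rfl⟩ := ι_surjective x
    rw [ι_comp_congr _ (e.comp (Abelian.Ext.mk₀ (r • 𝟙 M)) (add_zero _)) β hk
        (by rw [Exists.choose_spec (ι_surjective _).choose_spec, ι_smul]),
      ι_comp_congr _ e β hk (Exists.choose_spec (ι_surjective _).choose_spec)]
    rw [← Abelian.Ext.smul_eq_comp_mk₀, RingHom.id_apply, ← ι_smul,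
      ← Abelian.Ext.smul_eq_comp_mk₀, Abelian.Ext.smul_comp]

lemma compExt_ι {i j k n : ℕ} {M N : ModuleCat.{0} R}
    (β : Abelian.Ext.{0} M N j) (hk : i + j = k) (e : Abelian.Ext.{0} (quot I n) M i) :
    compExt β hk (ι I n e) = ι I n (e.comp β hk) :=
  ι_comp_congr _ e β hk (Exists.choose_spec (ι_surjective _).choose_spec)

end

section Unbundled

variable {R : Type} [CommRing R] (I : Ideal R) (i : ℕ)
  {M N P : Type} [AddCommGroup M] [Module R M] [AddCommGroup N] [Module R N]
  [AddCommGroup P] [Module R P]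

variable (M) in
/-- The local cohomology module `H^i_I(M)`. -/
noncomputable abbrev LC : ModuleCat.{0} R := (localCohomology I i).obj (ModuleCat.of R M)

/-- The map induced on local cohomology by a linear map. -/
noncomputable def map (f : M →ₗ[R] N) : LC I i M →ₗ[R] LC I i N :=
  ((localCohomology I i).map (ModuleCat.ofHom f)).hom

lemma map_ι' {n : ℕ} (f : M →ₗ[R] N)
    (e : Abelian.Ext.{0} (quot I n) (ModuleCat.of R M) i) :
    map I i f (ι I n e) = ι I n (e.comp (Abelian.Ext.mk₀ (ModuleCat.ofHom f)) (add_zero _)) :=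
  map_ι _ _

lemma map_id : map I i (LinearMap.id : M →ₗ[R] M) = LinearMap.id := by
  ext x
  obtain ⟨n, e, rfl⟩ := ι_surjective x
  rw [map_ι', ModuleCat.ofHom_id, Abelian.Ext.comp_mk₀_id]; rfl

lemma map_comp (g : N →ₗ[R] P) (f : M →ₗ[R] N) :
    map I i (g ∘ₗ f) = map I i g ∘ₗ map I i f := by
  ext x
  obtain ⟨n, e, rfl⟩ := ι_surjective x
  simp only [LinearMap.comp_apply, map_ι', ModuleCat.ofHom_comp]
  rw [← Abelian.Ext.mk₀_comp_mk₀, Abelian.Ext.comp_assoc_of_second_deg_zero]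

lemma map_smul_id (r : R) :
    map I i (r • LinearMap.id : M →ₗ[R] M) = r • LinearMap.id := by
  ext x
  obtain ⟨n, e, rfl⟩ := ι_surjective x
  rw [map_ι', LinearMap.smul_apply, LinearMap.id_apply, ← ι_smul]
  rfl

variable {f : M →ₗ[R] N} {g : N →ₗ[R] P}

/-- The short complex of modules given by an exact pair of linear maps. -/
noncomputable abbrev shortComplex (hfg : Function.Exact f g) : ShortComplex (ModuleCat.{0} R) :=
  ShortComplex.mk (ModuleCat.ofHom f) (ModuleCat.ofHom g) (by
    ext x; exact hfg.apply_apply_eq_zero x)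

lemma shortExact (hf : Function.Injective f) (hfg : Function.Exact f g)
    (hg : Function.Surjective g) : (shortComplex hfg).ShortExact where
  exact := (ShortComplex.ShortExact.moduleCat_exact_iff_function_exact _).2 hfg
  mono_f := (ModuleCat.mono_iff_injective _).2 hf
  epi_g := (ModuleCat.epi_iff_surjective _).2 hg

theorem map_exact (hf : Function.Injective f) (hfg : Function.Exact f g)
    (hg : Function.Surjective g) : Function.Exact (map I i f) (map I i g) := by
  have hS := shortExact hf hfg hg
  refine fun x ↦ ⟨fun hx ↦ ?_, ?_⟩
  · obtain ⟨n, e, rfl⟩ := ι_surjective x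
    rw [map_ι'] at hx
    obtain ⟨m, hm, h0⟩ := ι_eq_zero hx
    obtain ⟨e', he'⟩ := Abelian.Ext.covariant_sequence_exact₂ _ hS
      ((Abelian.Ext.mk₀ (proj I hm)).comp e (zero_add _)) (by
        rwa [Abelian.Ext.comp_assoc_of_third_deg_zero])
    refine ⟨ι I m e', ?_⟩
    rw [map_ι', ← ι_proj hm e]
    exact congrArg _ he'
  · rintro ⟨y, rfl⟩
    rw [← LinearMap.comp_apply, ← map_comp, hfg.linearMap_comp_eq_zero]
    obtain ⟨n, e, rfl⟩ := ι_surjective y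
    rw [map_ι', ModuleCat.ofHom_zero, Abelian.Ext.mk₀_zero, Abelian.Ext.comp_zero, ι_zero]

theorem exists_connecting (hf : Function.Injective f) (hfg : Function.Exact f g)
    (hg : Function.Surjective g) : ∃ δ : LC I i P →ₗ[R] LC I (i + 1) M,
      Function.Exact (map I i g) δ ∧ Function.Exact δ (map I (i + 1) f) := by
  have hS := shortExact hf hfg hg
  refine ⟨compExt hS.extClass rfl, fun x ↦ ⟨fun hx ↦ ?_, ?_⟩, fun x ↦ ⟨fun hx ↦ ?_, ?_⟩⟩
  · obtain ⟨n, e, rfl⟩ := ι_surjective x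
    rw [compExt_ι] at hx
    obtain ⟨m, hm, h0⟩ := ι_eq_zero hx
    obtain ⟨e', he'⟩ := Abelian.Ext.covariant_sequence_exact₃ _ hS
      ((Abelian.Ext.mk₀ (proj I hm)).comp e (zero_add _)) rfl (by
        rwa [Abelian.Ext.comp_assoc _ _ _ (zero_add i) rfl (by lia)])
    refine ⟨ι I m e', ?_⟩
    rw [map_ι', ← ι_proj hm e]
    exact congrArg _ he'
  · rintro ⟨y, rfl⟩
    obtain ⟨n, e, rfl⟩ := ι_surjective y
    rw [map_ι', compExt_ι, Abelian.Ext.comp_assoc_of_second_deg_zero]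
    have := hS.comp_extClass
    dsimp only at this
    rw [this, Abelian.Ext.comp_zero, ι_zero]
  · obtain ⟨n, e, rfl⟩ := ι_surjective x
    rw [map_ι'] at hx
    obtain ⟨m, hm, h0⟩ := ι_eq_zero hx
    obtain ⟨e', he'⟩ := Abelian.Ext.covariant_sequence_exact₁ _ hS
      ((Abelian.Ext.mk₀ (proj I hm)).comp e (zero_add _)) (by
        rwa [Abelian.Ext.comp_assoc_of_third_deg_zero]) rfl
    refine ⟨ι I m e', ?_⟩
    rw [compExt_ι, ← ι_proj hm e]
    exact congrArg _ he'
  · rintro ⟨y, rfl⟩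
    obtain ⟨n, e, rfl⟩ := ι_surjective y
    rw [compExt_ι, map_ι', Abelian.Ext.comp_assoc_of_third_deg_zero]
    have := hS.extClass_comp
    dsimp only at this
    rw [this, Abelian.Ext.comp_zero, ι_zero]

variable (M) in
theorem subsingleton_of_injective [Module.Injective R M] : Subsingleton (LC I (i + 1) M) := by
  have : Injective (ModuleCat.of R M) := Module.injective_object_of_injective_module R M
  refine subsingleton_of_forall_eq 0 fun x ↦ ?_
  obtain ⟨n, e, rfl⟩ := ι_surjective x
  rw [Abelian.Ext.eq_zero_of_injective e, ι_zero]

lemma ι_mk₀_eq {n m : ℕ} (h : n ≤ m) (φ : quot I n ⟶ ModuleCat.of R M) :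
    ι I n (Abelian.Ext.mk₀ φ) = ι I m (Abelian.Ext.mk₀ (proj I h ≫ φ)) := by
  rw [← ι_proj h, Abelian.Ext.mk₀_comp_mk₀]

lemma exists_ι_mk₀ (x : LC I 0 M) :
    ∃ (n : ℕ) (φ : quot I n ⟶ ModuleCat.of R M), x = ι I n (Abelian.Ext.mk₀ φ) := by
  obtain ⟨n, e, rfl⟩ := ι_surjective x
  obtain ⟨φ, rfl⟩ := (Abelian.Ext.mk₀_bijective _ _).2 e
  exact ⟨n, φ, rfl⟩

variable {I} in
/-- The value at `1` of a map out of `R / I ^ n`. -/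
noncomputable def evalOne {n : ℕ} (φ : quot I n ⟶ ModuleCat.of R M) : M :=
  φ.hom (Ideal.Quotient.mk (I ^ n) 1)

variable {I} in
lemma hom_quot_ext {n : ℕ} {φ ψ : quot I n ⟶ ModuleCat.of R M}
    (h : evalOne φ = evalOne ψ) : φ = ψ := by
  apply ModuleCat.hom_ext
  refine Submodule.linearMap_qext (I ^ n) ?_
  exact LinearMap.ext_ring h

lemma ι_mk₀_eq_iff {n n' : ℕ} (φ : quot I n ⟶ ModuleCat.of R M)
    (ψ : quot I n' ⟶ ModuleCat.of R M) :
    ι I n (Abelian.Ext.mk₀ φ) = ι I n' (Abelian.Ext.mk₀ ψ) ↔ evalOne φ = evalOne ψ := by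
  rw [ι_mk₀_eq I (le_max_left n n'), ι_mk₀_eq I (le_max_right n n')]
  constructor
  · intro h
    rw [← sub_eq_zero, ← ι_sub] at h
    obtain ⟨m, hm, h0⟩ := ι_eq_zero h
    have h1 : Abelian.Ext.mk₀ (proj I hm ≫ proj I (le_max_left n n') ≫ φ) =
        Abelian.Ext.mk₀ (proj I hm ≫ proj I (le_max_right n n') ≫ ψ) := by
      rw [← sub_eq_zero, ← Abelian.Ext.mk₀_comp_mk₀, ← Abelian.Ext.mk₀_comp_mk₀ (proj I hm),
        ← h0]
      simp [sub_eq_add_neg]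
    have h2 := (Abelian.Ext.mk₀_bijective _ _).1 h1
    exact congrArg (fun θ : quot I m ⟶ ModuleCat.of R M ↦ evalOne θ) h2
  · intro h
    congr 2
    apply hom_quot_ext
    exact h

/-- A representative of an element of `H^0_I(M)`. -/
lemma exists_eq_evalOne (x : LC I 0 M) :
    ∃ m : M, ∃ (n : ℕ) (φ : quot I n ⟶ ModuleCat.of R M),
      x = ι I n (Abelian.Ext.mk₀ φ) ∧ evalOne φ = m := by
  obtain ⟨n, φ, h⟩ := exists_ι_mk₀ I x
  exact ⟨_, n, φ, h, rfl⟩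

/-- The underlying function of `ev`. -/
noncomputable def evFun (x : LC I 0 M) : M := (exists_eq_evalOne I x).choose

lemma evFun_ι_mk₀ {n : ℕ} (φ : quot I n ⟶ ModuleCat.of R M) :
    evFun I (ι I n (Abelian.Ext.mk₀ φ)) = evalOne φ := by
  obtain ⟨m, ψ, h, h'⟩ := (exists_eq_evalOne I (ι I n (Abelian.Ext.mk₀ φ))).choose_spec
  rw [ι_mk₀_eq_iff] at h
  exact (h.trans h').symm

/-- The inclusion of `H^0_I(M)` into `M`. -/
noncomputable def ev : LC I 0 M →ₗ[R] M where
  toFun := evFun I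
  map_add' x y := by
    obtain ⟨n, φ, rfl⟩ := exists_ι_mk₀ I x
    obtain ⟨m, ψ, rfl⟩ := exists_ι_mk₀ I y
    have h : ι I n (Abelian.Ext.mk₀ φ) + ι I m (Abelian.Ext.mk₀ ψ) =
      ι I _ (Abelian.Ext.mk₀ (proj I (le_max_left n m) ≫ φ + proj I (le_max_right n m) ≫ ψ)) := by
      rw [ι_mk₀_eq I (le_max_left n m), ι_mk₀_eq I (le_max_right n m), Abelian.Ext.mk₀_add, ι_add]
    rw [h, evFun_ι_mk₀, evFun_ι_mk₀, evFun_ι_mk₀]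
    rfl
  map_smul' r x := by
    obtain ⟨n, φ, rfl⟩ := exists_ι_mk₀ I x
    have h : r • ι I n (Abelian.Ext.mk₀ φ) = ι I n (Abelian.Ext.mk₀ (r • φ)) := by
      rw [← ι_smul, ← Abelian.Ext.smul_eq_comp_mk₀, Abelian.Ext.mk₀_smul]
    rw [h, evFun_ι_mk₀, evFun_ι_mk₀]
    rfl

lemma ev_ι_mk₀ {n : ℕ} (φ : quot I n ⟶ ModuleCat.of R M) :
    ev I (ι I n (Abelian.Ext.mk₀ φ)) = evalOne φ := evFun_ι_mk₀ I φ

lemma ev_injective : Function.Injective (ev I (M := M)) := by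
  intro x y h
  obtain ⟨n, φ, rfl⟩ := exists_ι_mk₀ I x
  obtain ⟨m, ψ, rfl⟩ := exists_ι_mk₀ I y
  rwa [ev_ι_mk₀, ev_ι_mk₀, ← ι_mk₀_eq_iff] at h

lemma ev_map (f : M →ₗ[R] N) (x : LC I 0 M) : ev I (map I 0 f x) = f (ev I x) := by
  obtain ⟨n, φ, rfl⟩ := exists_ι_mk₀ I x
  rw [map_ι', Abelian.Ext.mk₀_comp_mk₀, ev_ι_mk₀, ev_ι_mk₀]
  rfl

lemma mem_range_ev (m : M) : m ∈ LinearMap.range (ev I (M := M)) ↔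
    ∃ n : ℕ, ∀ a ∈ I ^ n, a • m = 0 := by
  constructor
  · rintro ⟨x, rfl⟩
    obtain ⟨n, φ, rfl⟩ := exists_ι_mk₀ I x
    refine ⟨n, fun a ha ↦ ?_⟩
    rw [ev_ι_mk₀]
    have h1 : a • (Ideal.Quotient.mk (I ^ n) 1) = 0 := by
      rw [← Ideal.Quotient.mk_eq_mk, ← Submodule.Quotient.mk_smul, smul_eq_mul, mul_one]
      exact (Submodule.Quotient.mk_eq_zero _).2 ha
    exact (map_smul φ.hom a (Ideal.Quotient.mk (I ^ n) 1)).symm.trans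
      ((congrArg φ.hom h1).trans (map_zero φ.hom))
  · rintro ⟨n, hn⟩
    have hle : I ^ n ≤ LinearMap.ker (LinearMap.toSpanSingleton R M m) := fun a ha ↦ hn a ha
    let φ : quot I n ⟶ ModuleCat.of R M :=
      ModuleCat.ofHom (Submodule.liftQ (I ^ n) (LinearMap.toSpanSingleton R M m) hle)
    exact ⟨ι I n (Abelian.Ext.mk₀ φ), (ev_ι_mk₀ I φ).trans (one_smul R m)⟩

end Unbundled

end LocalCohomologyAux

open CategoryTheory in
theorem Module.exists_injective_embedding {R : Type} [CommRing R] (M : Type) [AddCommGroup M]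
    [Module R M] : ∃ (J : Type) (_ : AddCommGroup J) (_ : Module R J) (f : M →ₗ[R] J),
      Module.Injective R J ∧ Function.Injective f := by
  let X : ModuleCat.{0} R := CategoryTheory.Injective.under (ModuleCat.of R M)
  refine ⟨X, inferInstance, inferInstance, (CategoryTheory.Injective.ι (ModuleCat.of R M)).hom,
    ?_, ?_⟩
  · have : CategoryTheory.Injective (ModuleCat.of R X) :=
      inferInstanceAs (CategoryTheory.Injective (CategoryTheory.Injective.under (ModuleCat.of R M)))
    exact Module.injective_module_of_injective_object R _
  · exact (ModuleCat.mono_iff_injective _).1 inferInstance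

lemma Module.support_subset_union_of_exact {R : Type} [CommRing R] {A B C : Type}
    [AddCommGroup A] [Module R A] [AddCommGroup B] [Module R B] [AddCommGroup C] [Module R C]
    {f : A →ₗ[R] B} {g : B →ₗ[R] C} (h : Function.Exact f g) :
    Module.support R B ⊆ Module.support R A ∪ Module.support R C := by
  intro p hp
  by_contra hcon
  rw [Set.mem_union, not_or, Module.notMem_support_iff', Module.notMem_support_iff'] at hcon
  revert hp
  rw [imp_false, Module.notMem_support_iff']
  intro b
  obtain ⟨r, hr, hrb⟩ := hcon.2 (g b)
  rw [← map_smul] at hrb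
  obtain ⟨a, ha⟩ := (h _).1 hrb
  obtain ⟨s, hs, hsa⟩ := hcon.1 a
  refine ⟨s * r, p.2.mul_notMem hs hr, ?_⟩
  rw [mul_smul, ← ha, ← map_smul, hsa, map_zero]

lemma ringKrullDim_quotient_le_supportDim {R : Type} [CommRing R] {M : Type}
    [AddCommGroup M] [Module R M] {p : PrimeSpectrum R} (hp : p ∈ Module.support R M) :
    ringKrullDim (R ⧸ p.asIdeal) ≤ Module.supportDim R M := by
  rw [← Module.supportDim_quotient_eq_ringKrullDim, Module.supportDim]
  refine Order.krullDim_le_of_strictMono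
    (fun a ↦ ⟨a.1, Module.mem_support_mono ?_ hp⟩) fun {_ _} lt ↦ lt
  obtain ⟨a, ha⟩ := a
  rw [Module.support_eq_zeroLocus, Ideal.annihilator_quotient] at ha
  exact ha

/-- Induction along a prime filtration whose factors lie in a set containing the support. -/
theorem Module.prime_filtration_induction {R : Type} [CommRing R] [IsNoetherianRing R]
    (Z : Set (PrimeSpectrum R))
    (Q : ∀ (M : Type) [AddCommGroup M] [Module R M], Prop)
    (subsingleton : ∀ (M : Type) [AddCommGroup M] [Module R M] [Subsingleton M], Q M)
    (quotient : ∀ (M : Type) [AddCommGroup M] [Module R M] (p : PrimeSpectrum R), p ∈ Z →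
      (M ≃ₗ[R] R ⧸ p.asIdeal) → Q M)
    (exact : ∀ (A B C : Type) [AddCommGroup A] [Module R A] [AddCommGroup B] [Module R B]
      [AddCommGroup C] [Module R C] (f : A →ₗ[R] B) (g : B →ₗ[R] C), Function.Injective f →
      Function.Exact f g → Function.Surjective g → Q A → Q C → Q B)
    (M : Type) [AddCommGroup M] [Module R M] [Module.Finite R M]
    (hM : Module.support R M ⊆ Z) : Q M := by
  revert hM
  refine IsNoetherianRing.induction_on_isQuotientEquivQuotientPrime R
    (M := M) inferInstance (motive := fun N _ _ _ ↦ Module.support R N ⊆ Z → Q N) ?_ ?_ ?_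
  · intro N _ _ _ _ _
    exact subsingleton N
  · intro N _ _ _ p e h
    refine quotient N p (h ?_) e
    rw [e.support_eq, Module.support_eq_zeroLocus, Ideal.annihilator_quotient]
    exact le_refl p.asIdeal
  · intro A _ _ _ B _ _ _ C _ _ _ f g hf hg hfg hA hC h
    rw [Module.support_of_exact hfg hf hg] at h
    exact exact A B C f g hf hfg hg (hA (Set.subset_union_left.trans h))
      (hC (Set.subset_union_right.trans h))

lemma Module.supportDim_quotSMulTop_lt {R : Type} [CommRing R] {M : Type}
    [AddCommGroup M] [Module R M] [Module.Finite R M] {p : PrimeSpectrum R}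
    (e : M ≃ₗ[R] R ⧸ p.asIdeal) {x : R} (hx : x ∉ p.asIdeal) :
    Module.supportDim R (QuotSMulTop x M) + 1 ≤ Module.supportDim R M := by
  apply Module.supportDim_quotSMulTop_succ_le_of_notMem_minimalPrimes
  intro q hq
  rw [e.annihilator_eq, Ideal.annihilator_quotient, Ideal.minimalPrimes_eq_subsingleton_self] at hq
  rw [Set.mem_singleton_iff.1 hq]
  exact hx

lemma isSMulRegular_of_equiv_quotient {R : Type} [CommRing R] {M : Type}
    [AddCommGroup M] [Module R M] {p : PrimeSpectrum R}
    (e : M ≃ₗ[R] R ⧸ p.asIdeal) {x : R} (hx : x ∉ p.asIdeal) : IsSMulRegular M x := by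
  rw [isSMulRegular_iff_right_eq_zero_of_smul]
  intro m hm
  have h := congrArg e hm
  rw [map_smul, map_zero] at h
  obtain ⟨y, hy⟩ := Ideal.Quotient.mk_surjective (e m)
  rw [← hy, ← Ideal.Quotient.mk_eq_mk, ← Submodule.Quotient.mk_smul,
    Submodule.Quotient.mk_eq_zero, smul_eq_mul] at h
  have := (p.2.mem_or_mem h).resolve_left hx
  rw [← Ideal.Quotient.eq_zero_iff_mem, hy] at this
  exact (map_eq_zero_iff e e.injective).1 this

namespace LocalCohomologyAux

variable {R : Type} [CommRing R] (I : Ideal R) (i : ℕ)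
  {M N P : Type} [AddCommGroup M] [Module R M] [AddCommGroup N] [Module R N]
  [AddCommGroup P] [Module R P]

lemma map_zero_apply (x : LC I i M) : map I i (0 : M →ₗ[R] N) x = 0 := by
  have h : (0 : M →ₗ[R] N) = (0 : M →ₗ[R] N) ∘ₗ ((0 : R) • LinearMap.id) := by simp
  rw [h, map_comp, map_smul_id]
  simp

/-- Isomorphic modules have isomorphic local cohomology. -/
noncomputable def congr (e : M ≃ₗ[R] N) : LC I i M ≃ₗ[R] LC I i N :=
  LinearEquiv.ofLinearMap (map I i e.toLinearMap) (map I i e.symm.toLinearMap)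
    (by rw [← map_comp, LinearEquiv.comp_symm, map_id])
    (by rw [← map_comp, LinearEquiv.symm_comp, map_id])

variable (M) in
lemma subsingleton_of_subsingleton [Subsingleton M] : Subsingleton (LC I i M) := by
  refine subsingleton_of_forall_eq 0 fun x ↦ ?_
  have : (LinearMap.id : M →ₗ[R] M) = 0 := by ext m; exact Subsingleton.elim _ _
  rw [← LinearMap.id_apply (R := R) x, ← map_id, this, map_zero_apply]

variable {f : M →ₗ[R] N} {g : N →ₗ[R] P}

lemma subsingleton_of_exact (hf : Function.Injective f) (hfg : Function.Exact f g)
    (hg : Function.Surjective g) (h₁ : Subsingleton (LC I i M)) (h₂ : Subsingleton (LC I i P)) :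
    Subsingleton (LC I i N) := by
  refine subsingleton_of_forall_eq 0 fun x ↦ ?_
  obtain ⟨y, rfl⟩ := (map_exact I i hf hfg hg x).1 (Subsingleton.elim _ _)
  rw [Subsingleton.elim y 0, map_zero]

/-- Every element of a local cohomology module is killed by a power of the ideal. -/
theorem exists_pow_smul_eq_zero (x : LC I i M) : ∃ n : ℕ, ∀ a ∈ I ^ n, a • x = 0 := by
  obtain ⟨n, e, rfl⟩ := ι_surjective x
  refine ⟨n, fun a ha ↦ ?_⟩
  have h : a • CategoryTheory.CategoryStruct.id (quot I n) = 0 := by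
    apply ModuleCat.hom_ext
    refine Submodule.linearMap_qext (I ^ n) ?_
    refine LinearMap.ext_ring ?_
    have : a • (Ideal.Quotient.mk (I ^ n) 1) = 0 := by
      rw [← Ideal.Quotient.mk_eq_mk, ← Submodule.Quotient.mk_smul, smul_eq_mul, mul_one]
      exact (Submodule.Quotient.mk_eq_zero _).2 ha
    exact this
  rw [← ι_smul, ← CategoryTheory.Abelian.Ext.smul_eq_comp_mk₀,
    ← CategoryTheory.Abelian.Ext.mk₀_id_comp e, ← CategoryTheory.Abelian.Ext.smul_comp,
    ← CategoryTheory.Abelian.Ext.mk₀_smul, h, CategoryTheory.Abelian.Ext.mk₀_zero,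
    CategoryTheory.Abelian.Ext.zero_comp, ι_zero]

lemma exists_pow_smul_eq_zero_of_mem {x : R} (hx : x ∈ I) (t : LC I i M) :
    ∃ n : ℕ, x ^ n • t = 0 := by
  obtain ⟨n, hn⟩ := exists_pow_smul_eq_zero I i t
  exact ⟨n, hn _ (Ideal.pow_mem_pow hx n)⟩

lemma map_toLinearMap_smul (x : R) (t : LC I i M) :
    map I i (LinearMap.lsmul R M x) t = x • t := by
  have : LinearMap.lsmul R M x = x • LinearMap.id := by ext; simp
  rw [this, map_smul_id]; rfl

open Pointwise in
lemma exact_lsmul_mkQ (x : R) :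
    Function.Exact (LinearMap.lsmul R M x) (Submodule.mkQ (x • (⊤ : Submodule R M))) := by
  intro m
  rw [Submodule.mkQ_apply, Submodule.Quotient.mk_eq_zero, Submodule.mem_smul_pointwise_iff_exists]
  simp

/-- The `x`-torsion of `H^{i+1}(M)` is a quotient of `H^i(M/xM)` when `x` is `M`-regular. -/
theorem exists_quotSMulTop_connecting {x : R} (hx : IsSMulRegular M x) :
    ∃ δ : LC I i (QuotSMulTop x M) →ₗ[R] LC I (i + 1) M,
      Function.Exact δ (LinearMap.lsmul R (LC I (i + 1) M) x) := by
  obtain ⟨δ, -, h⟩ := exists_connecting I i (f := LinearMap.lsmul R M x) hx (exact_lsmul_mkQ x)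
    (Submodule.mkQ_surjective _)
  refine ⟨δ, fun t ↦ ?_⟩
  rw [← h t, map_toLinearMap_smul]
  rfl

theorem smul_surjective_of_subsingleton {x : R} (hx : IsSMulRegular M x)
    (h : Subsingleton (LC I i (QuotSMulTop x M))) (t : LC I i M) : ∃ t', x • t' = t := by
  obtain ⟨t', rfl⟩ := (map_exact I i (f := LinearMap.lsmul R M x) hx (exact_lsmul_mkQ x)
    (Submodule.mkQ_surjective _) t).1
    (Subsingleton.elim _ _)
  exact ⟨t', (map_toLinearMap_smul I i x t').symm⟩

theorem subsingleton_succ_of_quotSMulTop {x : R} (hxI : x ∈ I) (hx : IsSMulRegular M x)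
    (h : Subsingleton (LC I i (QuotSMulTop x M))) : Subsingleton (LC I (i + 1) M) := by
  obtain ⟨δ, hδ⟩ := exists_quotSMulTop_connecting I i hx
  have key : ∀ t : LC I (i + 1) M, x • t = 0 → t = 0 := by
    intro t ht
    obtain ⟨y, rfl⟩ := (hδ t).1 ht
    rw [Subsingleton.elim y 0, map_zero]
  refine subsingleton_of_forall_eq 0 fun t ↦ ?_
  obtain ⟨n, hn⟩ := exists_pow_smul_eq_zero_of_mem I (i + 1) hxI t
  induction n with
  | zero => simpa using hn
  | succ n ih => exact ih (key _ (by rwa [← mul_smul, ← pow_succ']))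

section Torsion

variable (M) in
/-- The submodule of elements killed by a power of `I`. -/
def gamma : Submodule R M where
  carrier := {m | ∃ n : ℕ, ∀ a ∈ I ^ n, a • m = 0}
  zero_mem' := ⟨0, by simp⟩
  add_mem' := by
    rintro x y ⟨n, hn⟩ ⟨m, hm⟩
    refine ⟨max n m, fun a ha ↦ ?_⟩
    rw [smul_add, hn a (Ideal.pow_le_pow_right (le_max_left n m) ha),
      hm a (Ideal.pow_le_pow_right (le_max_right n m) ha), add_zero]
  smul_mem' := by
    rintro r x ⟨n, hn⟩
    exact ⟨n, fun a ha ↦ by rw [smul_comm, hn a ha, smul_zero]⟩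

lemma mem_gamma {m : M} : m ∈ gamma I M ↔ ∃ n : ℕ, ∀ a ∈ I ^ n, a • m = 0 := Iff.rfl

lemma range_ev : LinearMap.range (ev I (M := M)) = gamma I M := by
  ext m; exact mem_range_ev I m

lemma exists_pow_smul_le_of_fg {B : Submodule R M} (hB : B.FG) (h : B ≤ gamma I M) :
    ∃ n : ℕ, ∀ a ∈ I ^ n, ∀ b ∈ B, a • b = 0 := by
  obtain ⟨s, rfl⟩ := hB
  choose! n hn using fun m (hm : m ∈ s) ↦ h (Submodule.subset_span hm)
  refine ⟨s.sup n, fun a ha b hb ↦ ?_⟩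
  induction hb using Submodule.span_induction with
  | mem x hx => exact hn x hx a (Ideal.pow_le_pow_right (Finset.le_sup hx) ha)
  | zero => simp
  | add x y _ _ hx hy => rw [smul_add, hx, hy, add_zero]
  | smul r x _ hx => rw [smul_comm, hx, smul_zero]

variable (M) in
theorem injective_gamma [IsNoetherianRing R] [Module.Injective R M] :
    Module.Injective R (gamma I M) := by
  refine Module.Baer.injective fun 𝔟 φ ↦ ?_
  have hrange : LinearMap.range ((gamma I M).subtype ∘ₗ φ) ≤ gamma I M := by
    rintro _ ⟨b, rfl⟩; exact (φ b).2
  obtain ⟨n, hn⟩ := exists_pow_smul_le_of_fg I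
    (LinearMap.range_eq_map ((gamma I M).subtype ∘ₗ φ) ▸ Submodule.FG.map _
      (IsNoetherian.noetherian _)) hrange
  obtain ⟨k, hk⟩ := Ideal.exists_pow_inf_eq_pow_smul (I := I) (M := R) 𝔟
  have hker : ∀ b : 𝔟, (b : R) ∈ I ^ (n + k) → φ b = 0 := by
    rintro ⟨b, hb⟩ hbI
    have h1 : b ∈ I ^ (n + k) • (⊤ : Submodule R R) ⊓ 𝔟 := ⟨by simpa using hbI, hb⟩
    rw [hk _ (by lia), Nat.add_sub_cancel] at h1
    have h2 : b ∈ I ^ n • 𝔟 := Submodule.smul_mono le_rfl inf_le_right h1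
    have h3 : ∀ c ∈ I ^ n • 𝔟, ∀ hc : c ∈ 𝔟, φ ⟨c, hc⟩ = 0 := by
      intro c hc
      induction hc using Submodule.smul_induction_on' with
      | smul r hr m hm =>
        intro hc
        have : (⟨r • m, hc⟩ : 𝔟) = r • ⟨m, hm⟩ := rfl
        rw [this, map_smul]
        exact Subtype.ext (hn r hr _ ⟨⟨m, hm⟩, rfl⟩)
      | add x hx y hy h1 h2 =>
        intro hc
        have hx' : x ∈ 𝔟 := Submodule.smul_le_right hx
        have hy' : y ∈ 𝔟 := Submodule.smul_le_right hy
        have : (⟨x + y, hc⟩ : 𝔟) = ⟨x, hx'⟩ + ⟨y, hy'⟩ := rfl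
        rw [this, map_add, h1, h2, add_zero]
    exact h3 b h2 hb
  -- factor through the image of `𝔟` in `R / I ^ (n + k)`
  let q : R →ₗ[R] R ⧸ I ^ (n + k) := Submodule.mkQ (I ^ (n + k))
  let p : 𝔟 →ₗ[R] LinearMap.range (q ∘ₗ 𝔟.subtype) := (q ∘ₗ 𝔟.subtype).rangeRestrict
  have hp : Function.Surjective p := LinearMap.surjective_rangeRestrict _
  have hkp : LinearMap.ker p ≤ LinearMap.ker φ := by
    intro b hb
    refine hker b ?_
    rw [LinearMap.ker_rangeRestrict] at hb
    exact (Submodule.Quotient.mk_eq_zero _).1 hb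
  let ψ : LinearMap.range (q ∘ₗ 𝔟.subtype) →ₗ[R] gamma I M :=
    (LinearMap.ker p).liftQ φ hkp ∘ₗ (p.quotKerEquivOfSurjective hp).symm.toLinearMap
  have hψ : ∀ b, ψ (p b) = φ b := by
    intro b
    have : (p.quotKerEquivOfSurjective hp).symm (p b) = Submodule.Quotient.mk b := by
      rw [LinearEquiv.symm_apply_eq]; rfl
    simp only [ψ, LinearMap.comp_apply, LinearEquiv.coe_coe, this]
    rfl
  obtain ⟨θ, hθ⟩ := Module.Injective.out (R := R) (Q := M)
    (LinearMap.range (q ∘ₗ 𝔟.subtype)).subtype (Submodule.injective_subtype _)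
    ((gamma I M).subtype ∘ₗ ψ)
  have hθ1 : ∀ r, θ (q r) ∈ gamma I M := by
    intro r
    refine ⟨n + k, fun a ha ↦ ?_⟩
    rw [← map_smul, ← map_smul]
    have : q (a • r) = 0 := (Submodule.Quotient.mk_eq_zero _).2 (Ideal.mul_mem_right _ _ ha)
    rw [this, map_zero]
  refine ⟨LinearMap.codRestrict (gamma I M) (θ ∘ₗ q) hθ1, fun x hx ↦ ?_⟩
  apply Subtype.ext
  have := hθ (p ⟨x, hx⟩)
  rw [LinearMap.comp_apply, hψ] at this
  exact this

theorem subsingleton_succ_of_injective_embedding {J : Type} [AddCommGroup J] [Module R J]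
    [Module.Injective R J] {f : M →ₗ[R] J} {g : J →ₗ[R] P} (hf : Function.Injective f)
    (hfg : Function.Exact f g) (hg : Function.Surjective g)
    (h : Function.Surjective (map I i g)) : Subsingleton (LC I (i + 1) M) := by
  obtain ⟨δ, h1, h2⟩ := exists_connecting I i hf hfg hg
  have := subsingleton_of_injective I i J
  refine subsingleton_of_forall_eq 0 fun t ↦ ?_
  obtain ⟨y, rfl⟩ := (h2 t).1 (Subsingleton.elim _ _)
  obtain ⟨z, rfl⟩ := h y
  exact (h1 _).2 ⟨z, rfl⟩

lemma map_zero_surjective (h : ∀ y ∈ gamma I N, ∃ x ∈ gamma I M, f x = y) :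
    Function.Surjective (map I 0 f) := by
  intro y
  obtain ⟨x, hx, hxy⟩ := h (ev I (M := N) y) (by rw [← range_ev]; exact ⟨y, rfl⟩)
  rw [← range_ev] at hx
  obtain ⟨z, rfl⟩ := hx
  exact ⟨z, ev_injective I (by rw [ev_map, hxy])⟩

/-- Higher local cohomology of an `I`-power torsion module vanishes. -/
theorem subsingleton_succ_of_gamma_eq_top [IsNoetherianRing R] (i : ℕ) :
    ∀ (M : Type) [AddCommGroup M] [Module R M], gamma I M = ⊤ → Subsingleton (LC I (i + 1) M) := by
  induction i with
  | zero =>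
    intro M _ _ hM
    obtain ⟨J, _, _, f, hJ, hf⟩ := Module.exists_injective_embedding (R := R) M
    have hfm : ∀ m, f m ∈ gamma I J := fun m ↦ by
      obtain ⟨n, hn⟩ := (hM ▸ Submodule.mem_top : m ∈ gamma I M)
      exact ⟨n, fun a ha ↦ by rw [← map_smul, hn a ha, map_zero]⟩
    have := injective_gamma I J
    let f' := LinearMap.codRestrict (gamma I J) f hfm
    refine subsingleton_succ_of_injective_embedding I 0 (f := f')
      (g := (LinearMap.range f').mkQ) (fun a b h ↦ hf (congrArg Subtype.val h))
      (LinearMap.exact_map_mkQ_range _) (Submodule.mkQ_surjective _) ?_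
    refine map_zero_surjective I fun y _ ↦ ?_
    obtain ⟨⟨x, n, hn⟩, rfl⟩ := Submodule.mkQ_surjective _ y
    exact ⟨⟨x, n, hn⟩, ⟨n, fun a ha ↦ Subtype.ext (hn a ha)⟩, rfl⟩
  | succ i ih =>
    intro M _ _ hM
    obtain ⟨J, _, _, f, hJ, hf⟩ := Module.exists_injective_embedding (R := R) M
    have hfm : ∀ m, f m ∈ gamma I J := fun m ↦ by
      obtain ⟨n, hn⟩ := (hM ▸ Submodule.mem_top : m ∈ gamma I M)
      exact ⟨n, fun a ha ↦ by rw [← map_smul, hn a ha, map_zero]⟩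
    have := injective_gamma I J
    let f' := LinearMap.codRestrict (gamma I J) f hfm
    refine subsingleton_succ_of_injective_embedding I (i + 1) (f := f')
      (g := (LinearMap.range f').mkQ) (fun a b h ↦ hf (congrArg Subtype.val h))
      (LinearMap.exact_map_mkQ_range _) (Submodule.mkQ_surjective _) ?_
    have := ih (gamma I J ⧸ LinearMap.range f') (by
      rw [eq_top_iff]
      rintro y -
      obtain ⟨⟨x, n, hn⟩, rfl⟩ := Submodule.mkQ_surjective _ y
      refine ⟨n, fun a ha ↦ ?_⟩
      have h0 : a • (⟨x, n, hn⟩ : gamma I J) = 0 := Subtype.ext (hn a ha)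
      rw [← map_smul, h0, map_zero])
    intro y
    exact ⟨0, Subsingleton.elim _ _⟩

lemma subsingleton_succ_of_equiv_quotient [IsNoetherianRing R] {p : PrimeSpectrum R}
    (hp : I ≤ p.asIdeal) (e : M ≃ₗ[R] R ⧸ p.asIdeal) : Subsingleton (LC I (i + 1) M) := by
  refine subsingleton_succ_of_gamma_eq_top I i M (eq_top_iff.2 fun m _ ↦ ⟨1, fun a ha ↦ ?_⟩)
  apply e.injective
  obtain ⟨y, hy⟩ := Ideal.Quotient.mk_surjective (e m)
  rw [map_smul, map_zero, ← hy, ← Ideal.Quotient.mk_eq_mk, ← Submodule.Quotient.mk_smul,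
    Submodule.Quotient.mk_eq_zero]
  exact Ideal.mul_mem_right _ _ (hp (by simpa using ha))

end Torsion

end LocalCohomologyAux

lemma Module.support_finite_of_supportDim_le_one {R : Type} [CommRing R] [IsLocalRing R]
    [IsNoetherianRing R] {N : Type} [AddCommGroup N] [Module R N] [Module.Finite R N]
    (h : Module.supportDim R N ≤ 1) : (Module.support R N).Finite := by
  have hfin : {p : PrimeSpectrum R | p.asIdeal ∈ (Module.annihilator R N).minimalPrimes}.Finite :=
    Set.Finite.preimage (fun _ _ _ _ h ↦ PrimeSpectrum.ext h)
      (Ideal.finite_minimalPrimes_of_isNoetherianRing R _)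
  refine (hfin.union (Set.finite_singleton (IsLocalRing.closedPoint R))).subset fun p hp ↦ ?_
  by_contra hcon
  rw [Set.mem_union, not_or] at hcon
  obtain ⟨h1, h2⟩ := hcon
  have hp' : Module.annihilator R N ≤ p.asIdeal := Module.annihilator_le_of_mem_support hp
  obtain ⟨q, hq, hqp⟩ := Ideal.exists_minimalPrimes_le hp'
  have hqprime : q.IsPrime := hq.1.1
  let q' : PrimeSpectrum R := ⟨q, hqprime⟩
  have hq' : q' ∈ Module.support R N := by
    rw [Module.support_eq_zeroLocus]; exact hq.1.2
  have hlt : q' < p := lt_of_le_of_ne hqp (by rintro rfl; exact h1 hq)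
  have hlt' : p < IsLocalRing.closedPoint R :=
    lt_of_le_of_ne (IsLocalRing.le_maximalIdeal p.2.ne_top) h2
  have hm : IsLocalRing.closedPoint R ∈ Module.support R N := Module.mem_support_mono hlt'.le hp
  let s₁ : LTSeries (Module.support R N) :=
    (RelSeries.singleton {(a, b) : Module.support R N × Module.support R N | a < b}
      ⟨q', hq'⟩).snoc ⟨p, hp⟩ (by exact hlt)
  have h₁ : s₁.last = ⟨p, hp⟩ := RelSeries.last_snoc _ _ _
  let s : LTSeries (Module.support R N) := s₁.snoc ⟨_, hm⟩ (h₁ ▸ hlt')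
  have := (Order.LTSeries.length_le_krullDim s).trans h
  have h3 : s.length = 2 := rfl
  rw [h3] at this
  exact absurd this (by decide)

namespace LocalCohomologyAux

variable {R : Type} [CommRing R]

lemma support_subset_of_exact_smul {T T' : Type} [AddCommGroup T] [Module R T] [AddCommGroup T']
    [Module R T'] {x : R} (δ : T' →ₗ[R] T) (hδ : Function.Exact δ (LinearMap.lsmul R T x))
    (hx : ∀ t : T, ∃ n : ℕ, x ^ n • t = 0) : Module.support R T ⊆ Module.support R T' := by
  intro p hp
  by_contra hcon
  revert hp
  rw [imp_false, Module.notMem_support_iff']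
  rw [Module.notMem_support_iff'] at hcon
  intro t
  obtain ⟨n, hn⟩ := hx t
  induction n generalizing t with
  | zero => exact ⟨1, p.2.one_notMem, by simpa using hn⟩
  | succ n ih =>
    have h0 : LinearMap.lsmul R T x (x ^ n • t) = 0 := by
      rwa [LinearMap.lsmul_apply, ← mul_smul, ← pow_succ']
    obtain ⟨y, hy⟩ := (hδ _).1 h0
    obtain ⟨r, hr, hry⟩ := hcon y
    obtain ⟨s, hs, hst⟩ := ih (r • t) (by rw [smul_comm, ← hy, ← map_smul, hry, map_zero])
    exact ⟨s * r, p.2.mul_notMem hs hr, by rw [mul_smul, hst]⟩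

variable [IsNoetherianRing R] (I : Ideal R)

/-- Grothendieck's vanishing theorem. -/
theorem subsingleton_of_supportDim_lt (c : ℕ) : ∀ (M : Type) [AddCommGroup M] [Module R M]
    [Module.Finite R M], Module.supportDim R M < c → Subsingleton (LC I c M) := by
  induction c with
  | zero =>
    intro M _ _ _ h
    have : Subsingleton M := by
      rw [← Module.supportDim_eq_bot_iff_subsingleton R]
      by_contra hne
      rw [← ne_eq, Module.supportDim_ne_bot_iff_nontrivial] at hne
      have : Nonempty (Module.support R M) :=
        Module.nonempty_support_of_nontrivial.to_subtype
      have := Order.krullDim_nonneg (α := Module.support R M)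
      exact absurd (this.trans_lt h) (lt_irrefl _)
    exact subsingleton_of_subsingleton I 0 M
  | succ c ih =>
    intro M _ _ _ h
    refine Module.prime_filtration_induction
      {p : PrimeSpectrum R | ringKrullDim (R ⧸ p.asIdeal) < (c + 1 : ℕ)}
      (fun M _ _ ↦ Subsingleton (LC I (c + 1) M)) ?_ ?_ ?_ M ?_
    · intro M _ _ _
      exact subsingleton_of_subsingleton I _ M
    · intro M _ _ p hp e
      by_cases hI : I ≤ p.asIdeal
      · exact subsingleton_succ_of_equiv_quotient I c hI e
      · obtain ⟨x, hxI, hxp⟩ := SetLike.not_le_iff_exists.1 hI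
        have : Module.Finite R M := Module.Finite.equiv e.symm
        refine subsingleton_succ_of_quotSMulTop I c hxI (isSMulRegular_of_equiv_quotient e hxp)
          (ih _ ?_)
        have h1 := Module.supportDim_quotSMulTop_lt e hxp
        rw [Module.supportDim_eq_of_equiv e, Module.supportDim_quotient_eq_ringKrullDim] at h1
        have h2 := h1.trans_lt hp
        push_cast at h2
        exact lt_of_add_lt_add_right h2
    · intro A B C _ _ _ _ _ _ f g hf hfg hg hA hC
      exact subsingleton_of_exact I _ hf hfg hg hA hC
    · intro p hp
      exact (ringKrullDim_quotient_le_supportDim hp).trans_lt h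

/-- The support of `H^{d-1}_I(N)` is finite when `dim N ≤ d`. -/
theorem support_finite [IsLocalRing R] (c : ℕ) : ∀ (M : Type) [AddCommGroup M] [Module R M]
    [Module.Finite R M], Module.supportDim R M ≤ (c + 1 : ℕ) →
    (Module.support R (LC I c M)).Finite := by
  induction c with
  | zero =>
    intro M _ _ _ h
    exact (Module.support_finite_of_supportDim_le_one (by simpa using h)).subset
      (Module.support_subset_of_injective (ev I) (ev_injective I))
  | succ c ih =>
    intro M _ _ _ h
    refine Module.prime_filtration_induction
      {p : PrimeSpectrum R | ringKrullDim (R ⧸ p.asIdeal) ≤ (c + 1 + 1 : ℕ)}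
      (fun M _ _ ↦ (Module.support R (LC I (c + 1) M)).Finite) ?_ ?_ ?_ M ?_
    · intro M _ _ _
      have := subsingleton_of_subsingleton I (c + 1) M
      rw [Module.support_eq_empty]
      exact Set.finite_empty
    · intro M _ _ p hp e
      by_cases hI : I ≤ p.asIdeal
      · have := subsingleton_succ_of_equiv_quotient I c hI e
        rw [Module.support_eq_empty]
        exact Set.finite_empty
      · obtain ⟨x, hxI, hxp⟩ := SetLike.not_le_iff_exists.1 hI
        have : Module.Finite R M := Module.Finite.equiv e.symm
        have hreg := isSMulRegular_of_equiv_quotient e hxp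
        obtain ⟨δ, hδ⟩ := exists_quotSMulTop_connecting I c hreg
        refine (ih (QuotSMulTop x M) ?_).subset (support_subset_of_exact_smul δ hδ
          (exists_pow_smul_eq_zero_of_mem I _ hxI))
        have h1 := Module.supportDim_quotSMulTop_lt e hxp
        rw [Module.supportDim_eq_of_equiv e, Module.supportDim_quotient_eq_ringKrullDim] at h1
        have h2 := h1.trans hp
        push_cast at h2 ⊢
        exact ENat.WithBot.add_le_add_one_right_iff.1 h2
    · intro A B C _ _ _ _ _ _ f g hf hfg hg hA hC
      exact (hA.union hC).subset (Module.support_subset_union_of_exact (map_exact I _ hf hfg hg))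
    · intro p hp
      exact (ringKrullDim_quotient_le_supportDim hp).trans h

end LocalCohomologyAux

section CompleteNoetherian

lemma IsAdicComplete.exists_sum_limit {S : Type*} [CommRing S] (n : Ideal S) [IsAdicComplete n S]
    (D : ℕ) (c : ℕ → S) (hc : ∀ i, c i ∈ n ^ (i - D)) :
    ∃ L : S, ∀ i, L - ∑ j ∈ Finset.range i, c j ∈ n ^ (i - D) := by
  have key : ∀ i k, ∑ j ∈ Finset.range (i + k), c j - ∑ j ∈ Finset.range i, c j ∈ n ^ (i - D) := by
    intro i k
    rw [Finset.sum_range_add, add_sub_cancel_left]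
    exact sum_mem fun j _ ↦ Ideal.pow_le_pow_right (by omega) (hc (i + j))
  obtain ⟨L, hL⟩ := IsPrecomplete.prec' (I := n) (M := S)
    (fun i ↦ ∑ j ∈ Finset.range (i + D), c j) (by
      intro a b hab
      rw [SModEq.sub_mem, smul_eq_mul, Ideal.mul_top, ← neg_mem_iff, neg_sub]
      have := key (a + D) (b - a)
      rwa [show a + D + (b - a) = b + D by omega, Nat.add_sub_cancel] at this)
  refine ⟨L, fun i ↦ ?_⟩
  rcases le_total i D with h | h
  · rw [Nat.sub_eq_zero_of_le h, pow_zero, Ideal.one_eq_top]; trivial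
  · have := hL (i - D)
    rwa [SModEq.sub_mem, smul_eq_mul, Ideal.mul_top, ← neg_mem_iff, neg_sub,
      Nat.sub_add_cancel h] at this

lemma Ideal.le_span_range_of_approx {S ι : Type*} [CommRing S] [Fintype ι] (n : Ideal S)
    [IsAdicComplete n S] (D : ℕ) (t : ι → S) (b : Ideal S)
    (h : ∀ i, ∀ x ∈ b, x ∈ n ^ i → ∃ c : ι → S, (∀ k, c k ∈ n ^ (i - D)) ∧
      x - ∑ k, c k * t k ∈ b ⊓ n ^ (i + 1)) : b ≤ Ideal.span (Set.range t) := by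
  choose! c hc hx using h
  intro x hxb
  let s : ℕ → S := fun i ↦ Nat.rec x (fun i y ↦ y - ∑ k, c i y k * t k) i
  have hs : ∀ i, s i ∈ b ∧ s i ∈ n ^ i := by
    intro i
    induction i with
    | zero => exact ⟨hxb, by rw [pow_zero, Ideal.one_eq_top]; trivial⟩
    | succ i ih => exact hx i (s i) ih.1 ih.2
  have hsum : ∀ i, x - ∑ k, (∑ j ∈ Finset.range i, c j (s j) k) * t k = s i := by
    intro i
    induction i with
    | zero => simp [s]
    | succ i ih =>
      have : s (i + 1) = s i - ∑ k, c i (s i) k * t k := rfl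
      simp_rw [this, Finset.sum_range_succ, add_mul, Finset.sum_add_distrib]
      rw [← sub_sub, ih]
  choose L hL using fun k ↦ IsAdicComplete.exists_sum_limit n D (fun j ↦ c j (s j) k)
    (fun i ↦ hc i (s i) (hs i).1 (hs i).2 k)
  have hxL : x = ∑ k, L k * t k := by
    rw [← sub_eq_zero]
    refine IsHausdorff.haus' (I := n) _ fun i ↦ ?_
    rw [SModEq.zero, smul_eq_mul, Ideal.mul_top]
    have h1 : x - ∑ k, L k * t k = s (i + D) -
        ∑ k, (L k - ∑ j ∈ Finset.range (i + D), c j (s j) k) * t k := by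
      rw [← hsum (i + D)]
      simp_rw [sub_mul, Finset.sum_sub_distrib]
      ring
    rw [h1]
    refine sub_mem (Ideal.pow_le_pow_right (by omega) (hs (i + D)).2)
      (_root_.sum_mem fun k _ ↦ Ideal.mul_mem_right _ _ ?_)
    simpa using hL k (i + D)
  rw [hxL]
  exact _root_.sum_mem fun k _ ↦ Ideal.mul_mem_left _ _ (Ideal.subset_span ⟨k, rfl⟩)

open Polynomial in
/-- The ideal of leading forms of an ideal of an adically complete algebra, inside the Rees
algebra of the base. -/
def Ideal.leadingForms {R S : Type*} [CommRing R] [CommRing S] [Algebra R S] (m : Ideal R)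
    (b : Ideal S) : Ideal (reesAlgebra m) where
  carrier := {f | ∀ n, ∃ t ∈ b,
    t - algebraMap R S ((f : R[X]).coeff n) ∈ m.map (algebraMap R S) ^ (n + 1)}
  zero_mem' n := ⟨0, b.zero_mem, by simp⟩
  add_mem' {f g} hf hg n := by
    obtain ⟨t, ht, ht'⟩ := hf n
    obtain ⟨u, hu, hu'⟩ := hg n
    refine ⟨t + u, b.add_mem ht hu, ?_⟩
    have := add_mem ht' hu'
    simp only [AddMemClass.coe_add, coeff_add, map_add]
    convert this using 1
    ring
  smul_mem' g f hf n := by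
    choose t ht ht' using hf
    refine ⟨∑ p ∈ Finset.HasAntidiagonal.antidiagonal n,
      algebraMap R S ((g : R[X]).coeff p.1) * t p.2,
      _root_.sum_mem fun p _ ↦ b.mul_mem_left _ (ht _), ?_⟩
    simp only [smul_eq_mul, MulMemClass.coe_mul, coeff_mul, map_sum, map_mul]
    rw [← Finset.sum_sub_distrib]
    refine _root_.sum_mem fun p hp ↦ ?_
    rw [← mul_sub, show n + 1 = p.1 + (p.2 + 1) by
        rw [← Finset.HasAntidiagonal.mem_antidiagonal.1 hp]; ring,
      pow_add]
    refine Ideal.mul_mem_mul ?_ (ht' _)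
    rw [← Ideal.map_pow]
    exact Ideal.mem_map_of_mem _ (g.2 p.1)

open Polynomial in
theorem IsNoetherianRing.of_isAdicComplete_map {R S : Type*} [CommRing R] [IsNoetherianRing R]
    [CommRing S] [Algebra R S] (m : Ideal R) [IsAdicComplete (m.map (algebraMap R S)) S]
    (h : ∀ x : S, ∃ a : R, x - algebraMap R S a ∈ m.map (algebraMap R S)) :
    IsNoetherianRing S := by
  set n := m.map (algebraMap R S) with hn
  have h' : ∀ i, ∀ x ∈ n ^ i, ∃ a ∈ m ^ i, x - algebraMap R S a ∈ n ^ (i + 1) := by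
    intro i x hx
    rw [hn, ← Ideal.map_pow, Ideal.map] at hx
    induction hx using Submodule.span_induction with
    | mem x hx =>
      obtain ⟨a, ha, rfl⟩ := hx
      exact ⟨a, ha, by simp⟩
    | zero => exact ⟨0, zero_mem _, by simp⟩
    | add x y _ _ hx hy =>
      obtain ⟨a, ha, ha'⟩ := hx
      obtain ⟨c, hc, hc'⟩ := hy
      refine ⟨a + c, add_mem ha hc, ?_⟩
      convert add_mem ha' hc' using 1
      rw [map_add]; ring
    | smul s x _ hx =>
      obtain ⟨a, ha, ha'⟩ := hx
      obtain ⟨c, hc⟩ := h s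
      refine ⟨c * a, Ideal.mul_mem_left _ _ ha, ?_⟩
      have h1 : algebraMap R S a ∈ n ^ i := by
        rw [hn, ← Ideal.map_pow]; exact Ideal.mem_map_of_mem _ ha
      have h2 : s • x - algebraMap R S (c * a) = s * (x - algebraMap R S a) +
          (s - algebraMap R S c) * algebraMap R S a := by
        rw [map_mul, smul_eq_mul]; ring
      rw [h2]
      refine add_mem (Ideal.mul_mem_left _ _ ha') ?_
      rw [pow_succ']
      exact Ideal.mul_mem_mul hc h1
  refine (isNoetherianRing_iff_ideal_fg S).2 fun b ↦ ?_
  obtain ⟨r, f, hf⟩ := Submodule.fg_iff_exists_fin_generating_family.1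
    ((isNoetherianRing_iff_ideal_fg (reesAlgebra m)).1 inferInstance (Ideal.leadingForms m b))
  have hfm : ∀ k, f k ∈ Ideal.leadingForms m b := fun k ↦ hf ▸ Submodule.subset_span ⟨k, rfl⟩
  choose t ht ht' using hfm
  let D : ℕ := Finset.univ.sup fun k ↦ (f k : R[X]).natDegree
  have hD : ∀ k, (f k : R[X]).natDegree ≤ D := fun k ↦
    Finset.le_sup (f := fun k ↦ (f k : R[X]).natDegree) (Finset.mem_univ k)
  let t' : Fin r × Fin (D + 1) → S := fun kj ↦ t kj.1 kj.2
  have hle : b ≤ Ideal.span (Set.range t') := by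
    refine Ideal.le_span_range_of_approx n D t' b fun i x hxb hxi ↦ ?_
    obtain ⟨a, ha, hxa⟩ := h' i x hxi
    have hmem : (⟨monomial i a, reesAlgebra.monomial_mem.2 ha⟩ : reesAlgebra m) ∈
        Ideal.leadingForms m b := by
      intro j
      by_cases hij : j = i
      · subst hij
        exact ⟨x, hxb, by simpa using hxa⟩
      · exact ⟨0, b.zero_mem, by simp [coeff_monomial, Ne.symm hij]⟩
    rw [← hf] at hmem
    obtain ⟨g, hg⟩ := (Submodule.mem_span_range_iff_exists_fun _).1 hmem
    have hga : a = ∑ kj : Fin r × Fin (D + 1),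
        if (kj.2 : ℕ) ≤ i then (g kj.1 : R[X]).coeff (i - kj.2) * (f kj.1 : R[X]).coeff kj.2
        else 0 := by
      have h1 := congrArg (fun p : reesAlgebra m ↦ (p : R[X]).coeff i) hg
      simp only [smul_eq_mul, coeff_monomial, if_true] at h1
      rw [← h1, Fintype.sum_prod_type]
      simp only [AddSubmonoidClass.coe_finsetSum, finsetSum_coeff, MulMemClass.coe_mul]
      refine Finset.sum_congr rfl fun k _ ↦ ?_
      rw [coeff_mul, ← Finset.Nat.sum_antidiagonal_swap,
        Finset.Nat.sum_antidiagonal_eq_sum_range_succ_mk]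
      dsimp only [Prod.fst_swap, Prod.snd_swap]
      rw [Fin.sum_univ_eq_sum_range (fun j ↦ if j ≤ i then
        (g k : R[X]).coeff (i - j) * (f k : R[X]).coeff j else 0)]
      rw [← Finset.sum_filter]
      refine (Finset.sum_subset ?_ ?_).symm
      · intro j hj
        simp only [Finset.mem_filter, Finset.mem_range] at hj ⊢
        omega
      · intro j hj hj'
        simp only [Finset.mem_filter, Finset.mem_range, not_and, not_le] at hj hj'
        rw [coeff_eq_zero_of_natDegree_lt (lt_of_le_of_lt (hD k) (by omega)), mul_zero]
    refine ⟨fun kj ↦ if (kj.2 : ℕ) ≤ i then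
      algebraMap R S ((g kj.1 : R[X]).coeff (i - kj.2)) else 0, fun kj ↦ ?_, ?_, ?_⟩
    · dsimp only
      split_ifs with hji
      · refine Ideal.pow_le_pow_right (m := i - D) (n := i - kj.2) (by omega) ?_
        rw [hn, ← Ideal.map_pow]
        exact Ideal.mem_map_of_mem _ ((g kj.1).2 _)
      · exact zero_mem _
    · exact sub_mem hxb (sum_mem fun kj _ ↦ b.mul_mem_left _ (ht _ _))
    · have h2 : x - ∑ kj : Fin r × Fin (D + 1), (if (kj.2 : ℕ) ≤ i then
          algebraMap R S ((g kj.1 : R[X]).coeff (i - kj.2)) else 0) * t' kj =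
          (x - algebraMap R S a) - ∑ kj : Fin r × Fin (D + 1), (if (kj.2 : ℕ) ≤ i then
          algebraMap R S ((g kj.1 : R[X]).coeff (i - kj.2)) *
          (t' kj - algebraMap R S ((f kj.1 : R[X]).coeff kj.2)) else 0) := by
        conv_rhs => rw [hga]
        rw [map_sum, sub_sub, ← Finset.sum_add_distrib]
        congr 1
        refine Finset.sum_congr rfl fun kj _ ↦ ?_
        split_ifs
        · rw [map_mul]; ring
        · simp
      rw [h2]
      refine sub_mem hxa (sum_mem fun kj _ ↦ ?_)
      split_ifs with hji
      · rw [show i + 1 = (i - kj.2) + (kj.2 + 1) by omega, pow_add]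
        refine Ideal.mul_mem_mul ?_ (ht' _ _)
        rw [hn, ← Ideal.map_pow]
        exact Ideal.mem_map_of_mem _ ((g kj.1).2 _)
      · exact zero_mem _
  have heq : b = Ideal.span (Set.range t') := by
    refine le_antisymm hle (Ideal.span_le.2 ?_)
    rintro _ ⟨kj, rfl⟩
    exact ht _ _
  rw [heq]
  exact (Submodule.fg_span (Set.finite_range t'))

theorem AdicCompletion.isNoetherianRing {R : Type*} [CommRing R] [IsNoetherianRing R]
    (m : Ideal R) : IsNoetherianRing (AdicCompletion m R) := by
  have := AdicCompletion.isAdicComplete_self m m.fg_of_isNoetherianRing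
  refine IsNoetherianRing.of_isAdicComplete_map (R := R) m fun x ↦ ?_
  obtain ⟨a, ha⟩ := Ideal.Quotient.mk_surjective (AdicCompletion.evalOneₐ m x)
  refine ⟨a, ?_⟩
  rw [← AdicCompletion.ker_evalOneₐ_eq_map m m.fg_of_isNoetherianRing, RingHom.mem_ker]
  have h1 := congrArg (fun φ ↦ φ a) (AdicCompletion.evalOneₐ_comp_algebraMap_eq_mk m)
  simp only [RingHom.comp_apply] at h1
  rw [map_sub, sub_eq_zero]
  exact ha.symm.trans h1.symm

end CompleteNoetherian

section FlatInjective

open TensorProduct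

variable {R : Type} [CommRing R]

/-- The linear map `W ^ ι → W ^ κ` given by a matrix with entries in the base ring. -/
noncomputable def Module.matrixMap {ι κ : Type} [Fintype ι] (c : κ → ι → R) (W : Type)
    [AddCommGroup W] [Module R W] : (ι → W) →ₗ[R] (κ → W) :=
  LinearMap.pi fun k ↦ ∑ i, c k i • LinearMap.proj i

@[simp]
lemma Module.matrixMap_apply {ι κ : Type} [Fintype ι] (c : κ → ι → R) {W : Type}
    [AddCommGroup W] [Module R W] (v : ι → W) (k : κ) :
    Module.matrixMap c W v k = ∑ i, c k i • v i := by
  simp [Module.matrixMap]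

variable {S : Type} [CommRing S] [Algebra R S]

lemma Module.piRight_lTensor_matrixMap {ι κ : Type} [Fintype ι] [Fintype κ] [DecidableEq ι]
    [DecidableEq κ] (c : κ → ι → R) {W : Type} [AddCommGroup W] [Module R W]
    (z : S ⊗[R] (ι → W)) :
    TensorProduct.piRight R R S (fun _ : κ ↦ W) ((Module.matrixMap c W).lTensor S z) =
      Module.matrixMap c (S ⊗[R] W) (TensorProduct.piRight R R S (fun _ : ι ↦ W) z) := by
  induction z with
  | zero => simp
  | add x y hx hy => simp only [map_add, hx, hy]
  | tmul s v =>
    ext k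
    simp [TensorProduct.tmul_sum]

theorem Module.exact_matrixMap_tensor [Module.Flat R S] {ι κ μ : Type} [Fintype ι] [Fintype κ]
    [Fintype μ] {a : ι → μ → R} {c : κ → ι → R} {W : Type} [AddCommGroup W] [Module R W]
    (h : Function.Exact (Module.matrixMap a W) (Module.matrixMap c W)) :
    Function.Exact (Module.matrixMap a (S ⊗[R] W)) (Module.matrixMap c (S ⊗[R] W)) := by
  classical
  have h' := Module.Flat.lTensor_exact S h
  intro y
  obtain ⟨z, rfl⟩ := (TensorProduct.piRight R R S (fun _ : ι ↦ W)).surjective y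
  rw [← Module.piRight_lTensor_matrixMap, LinearEquiv.map_eq_zero_iff, h' z]
  constructor
  · rintro ⟨w, rfl⟩
    exact ⟨_, (Module.piRight_lTensor_matrixMap a w).symm⟩
  · rintro ⟨w, hw⟩
    obtain ⟨w, rfl⟩ := (TensorProduct.piRight R R S (fun _ : μ ↦ W)).surjective w
    rw [← Module.piRight_lTensor_matrixMap] at hw
    exact ⟨w, LinearEquiv.injective _ hw⟩

theorem Module.injective_tensorProduct [IsNoetherianRing R] [Module.Flat R S] (J : Type)
    [AddCommGroup J] [Module R J] [hJ : Module.Injective R J] :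
    Module.Injective R (S ⊗[R] J) := by
  have hB : Module.Baer R J := Module.Baer.of_injective hJ
  refine Module.Baer.injective fun b g ↦ ?_
  obtain ⟨n, β, hβ⟩ := Submodule.fg_iff_exists_fin_generating_family.1
    (Module.finite_def.1 (inferInstance : Module.Finite R b))
  let π : (Fin n → R) →ₗ[R] b := Fintype.linearCombination R β
  have hπ : ∀ t, π t = ∑ i, t i • β i := fun t ↦ Fintype.linearCombination_apply R β t
  have hπs : Function.Surjective π := by
    rw [← LinearMap.range_eq_top, Fintype.range_linearCombination, hβ]
  obtain ⟨r, ρ, hρ⟩ := Submodule.fg_iff_exists_fin_generating_family.1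
    (IsNoetherian.noetherian (LinearMap.ker π))
  have hρ0 : ∀ k, π (ρ k) = 0 := fun k ↦ by
    rw [← LinearMap.mem_ker, ← hρ]; exact Submodule.subset_span ⟨k, rfl⟩
  let a : Fin n → Unit → R := fun i _ ↦ (β i : R)
  have hex : Function.Exact (Module.matrixMap a J) (Module.matrixMap ρ J) := by
    intro v
    constructor
    · intro hv
      let φ : (Fin n → R) →ₗ[R] J := Fintype.linearCombination R v
      have hφ : LinearMap.ker π ≤ LinearMap.ker φ := by
        rw [← hρ, Submodule.span_le]
        rintro _ ⟨k, rfl⟩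
        have := congrFun hv k
        rw [Module.matrixMap_apply] at this
        rw [SetLike.mem_coe, LinearMap.mem_ker, Fintype.linearCombination_apply]
        exact this
      let h : b →ₗ[R] J := (LinearMap.ker π).liftQ φ hφ ∘ₗ
        (π.quotKerEquivOfSurjective hπs).symm.toLinearMap
      have hh : ∀ t, h (π t) = φ t := by
        intro t
        have : (π.quotKerEquivOfSurjective hπs).symm (π t) = (LinearMap.ker π).mkQ t := by
          rw [LinearEquiv.symm_apply_eq]; rfl
        simp only [h, LinearMap.comp_apply, LinearEquiv.coe_coe, this]
        exact Submodule.liftQ_apply _ _ _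
      obtain ⟨g', hg'⟩ := hB b h
      refine ⟨fun _ ↦ g' 1, ?_⟩
      ext i
      have h1 : π (Pi.single i 1) = β i := by
        rw [hπ]; simp [Pi.single_apply, ite_smul]
      have h2 : φ (Pi.single i 1) = v i := by
        rw [Fintype.linearCombination_apply]; simp [Pi.single_apply, ite_smul]
      rw [Module.matrixMap_apply, ← h2, ← hh, h1, ← hg' _ (β i).2]
      simp [a, ← map_smul]
    · rintro ⟨y, rfl⟩
      ext k
      have := congrArg (fun x : b ↦ (x : R)) (hρ0 k)
      simp only [hπ] at this
      simp only [Module.matrixMap_apply, a, Finset.univ_unique, Finset.sum_singleton, smul_smul,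
        ← Finset.sum_smul]
      convert zero_smul R (y ())
      · simpa using this
      · rfl
  obtain ⟨y, hy⟩ := (Module.exact_matrixMap_tensor (S := S) hex (fun i ↦ g (β i))).1 (by
    ext k
    rw [Module.matrixMap_apply, Pi.zero_apply, ← map_zero g, ← hρ0 k, hπ, map_sum]
    simp only [map_smul])
  refine ⟨LinearMap.toSpanSingleton R _ (y ()), fun x hx ↦ ?_⟩
  obtain ⟨t, ht⟩ := hπs ⟨x, hx⟩
  rw [← ht, hπ, map_sum]
  have hx' : x = ∑ i, t i * (β i : R) := by
    have := congrArg (fun x : b ↦ (x : R)) ht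
    simp only [hπ] at this
    simpa using this.symm
  simp only [map_smul, LinearMap.toSpanSingleton_apply]
  rw [hx', Finset.sum_smul]
  refine Finset.sum_congr rfl fun i _ ↦ ?_
  have := congrFun hy i
  rw [Module.matrixMap_apply] at this
  rw [← this, mul_smul]
  simp [a]

theorem Module.injective_restrictScalars_of_flat [Module.Flat R S] (E : Type) [AddCommGroup E]
    [Module R E] [Module S E] [IsScalarTower R S E] [hE : Module.Injective S E] :
    Module.Injective R E := by
  refine Module.Baer.injective fun b g ↦ ?_
  let f : S ⊗[R] b →ₗ[S] S ⊗[R] R := AlgebraTensorModule.lTensor S S b.subtype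
  have hf : Function.Injective f :=
    Module.Flat.lTensor_preserves_injective_linearMap (M := S) b.subtype b.injective_subtype
  let g' : S ⊗[R] b →ₗ[S] E := AlgebraTensorModule.lift
    ((LinearMap.toSpanSingleton S (b →ₗ[R] E) g).restrictScalars S)
  obtain ⟨h, hh⟩ := Module.Injective.out f hf g'
  refine ⟨(h.restrictScalars R) ∘ₗ (TensorProduct.mk R S R 1), fun x hx ↦ ?_⟩
  have := hh (1 ⊗ₜ ⟨x, hx⟩)
  simpa [f, g'] using this

end FlatInjective

namespace LocalCohomologyAux

open TensorProduct

variable {R : Type} [CommRing R] (I : Ideal R) {S : Type} [CommRing S] [Algebra R S]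

lemma mem_gamma_map_iff {W : Type} [AddCommGroup W] [Module R W] [Module S W]
    [IsScalarTower R S W] {w : W} :
    w ∈ gamma (I.map (algebraMap R S)) W ↔ w ∈ gamma I W := by
  rw [mem_gamma, mem_gamma]
  refine exists_congr fun n ↦ ?_
  rw [← Ideal.map_pow]
  constructor
  · intro h a ha
    rw [← algebraMap_smul S]
    exact h _ (Ideal.mem_map_of_mem _ ha)
  · intro h a ha
    rw [Ideal.map] at ha
    induction ha using Submodule.span_induction with
    | mem a ha =>
      obtain ⟨a, ha, rfl⟩ := ha
      rw [algebraMap_smul]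
      exact h a ha
    | zero => exact zero_smul _ _
    | add a b _ _ ha hb => rw [add_smul, ha, hb, add_zero]
    | smul s a _ ha => rw [smul_assoc, ha, smul_zero]

lemma exists_section_mkQ {W E : Type} [AddCommGroup W] [Module R W] [AddCommGroup E] [Module R E]
    [Module.Injective R W] (f : W →ₗ[R] E) (hf : Function.Injective f) :
    ∃ σ : (E ⧸ LinearMap.range f) →ₗ[R] E, ∀ y, (LinearMap.range f).mkQ (σ y) = y := by
  obtain ⟨ρ, hρ⟩ := Module.Injective.out (R := R) f hf (LinearMap.id : W →ₗ[R] W)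
  have hρ' : ∀ w, ρ (f w) = w := hρ
  refine ⟨(LinearMap.range f).liftQ (LinearMap.id - f ∘ₗ ρ) ?_, fun y ↦ ?_⟩
  · rintro _ ⟨w, rfl⟩
    rw [LinearMap.mem_ker, LinearMap.sub_apply, LinearMap.comp_apply, hρ', LinearMap.id_apply,
      sub_self]
  · obtain ⟨e, rfl⟩ := Submodule.mkQ_surjective _ y
    change (LinearMap.range f).mkQ (e - f (ρ e)) = _
    rw [map_sub, sub_eq_self]
    exact (Submodule.Quotient.mk_eq_zero _).2 ⟨_, rfl⟩

/-- Modules that are injective over `R` are acyclic for `Γ_{IS}` when `S` is flat over `R`. -/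
theorem subsingleton_of_injective_restrictScalars [Module.Flat R S] (i : ℕ) :
    ∀ (W : Type) [AddCommGroup W] [Module R W] [Module S W] [IsScalarTower R S W]
      [Module.Injective R W], Subsingleton (LC (I.map (algebraMap R S)) (i + 1) W) := by
  have key : ∀ (W : Type) [AddCommGroup W] [Module R W] [Module S W] [IsScalarTower R S W]
      [Module.Injective R W], ∃ (E C : Type) (_ : AddCommGroup E) (_ : Module S E)
      (_ : AddCommGroup C) (_ : Module R C) (_ : Module S C) (_ : IsScalarTower R S C)
      (f : W →ₗ[S] E) (g : E →ₗ[S] C), Module.Injective S E ∧ Module.Injective R C ∧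
      Function.Injective f ∧ Function.Exact f g ∧ Function.Surjective g ∧
      ∀ y ∈ gamma (I.map (algebraMap R S)) C, ∃ x ∈ gamma (I.map (algebraMap R S)) E,
        g x = y := by
    intro W _ _ _ _ _
    obtain ⟨E, _, _, f, hE, hf⟩ := Module.exists_injective_embedding (R := S) W
    let _ : Module R E := Module.compHom E (algebraMap R S)
    have : IsScalarTower R S E := ⟨fun r s x ↦ by
      rw [Algebra.smul_def, mul_smul]; rfl⟩
    have hER : Module.Injective R E := Module.injective_restrictScalars_of_flat (S := S) E
    obtain ⟨σ', hσ'⟩ := exists_section_mkQ (f.restrictScalars R) hf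
    let e : (E ⧸ LinearMap.range f) ≃ₗ[R] E ⧸ LinearMap.range (f.restrictScalars R) :=
      Submodule.Quotient.restrictScalarsEquiv R (LinearMap.range f) |>.symm
    let g : E →ₗ[S] E ⧸ LinearMap.range f := (LinearMap.range f).mkQ
    have hgs : Function.Surjective g := Submodule.mkQ_surjective _
    let σ : (E ⧸ LinearMap.range f) →ₗ[R] E := σ' ∘ₗ e.toLinearMap
    have hgσ : ∀ y, g (σ y) = y := fun y ↦ e.injective (hσ' (e y))
    refine ⟨E, E ⧸ LinearMap.range f, _, _, _, _, _, inferInstance, f, g, hE, ?_, hf, ?_,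
      hgs, ?_⟩
    · refine ⟨fun X Y _ _ _ _ i hi φ ↦ ?_⟩
      obtain ⟨h, hh⟩ := Module.Injective.out (R := R) i hi (σ ∘ₗ φ)
      exact ⟨g.restrictScalars R ∘ₗ h, fun x ↦ by
        rw [LinearMap.comp_apply, hh]; exact hgσ _⟩
    · exact LinearMap.exact_map_mkQ_range f
    · intro y hy
      refine ⟨σ y, ?_, hgσ y⟩
      rw [mem_gamma_map_iff] at hy ⊢
      obtain ⟨n, hn⟩ := hy
      exact ⟨n, fun a ha ↦ by rw [← map_smul, hn a ha, map_zero]⟩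
  induction i with
  | zero =>
    intro W _ _ _ _ _
    obtain ⟨E, C, _, _, _, _, _, _, f, g, hE, hC, hf, hfg, hg, h⟩ := key W
    exact subsingleton_succ_of_injective_embedding _ 0 hf hfg hg (map_zero_surjective _ h)
  | succ i ih =>
    intro W _ _ _ _ _
    obtain ⟨E, C, _, _, _, _, _, _, f, g, hE, hC, hf, hfg, hg, h⟩ := key W
    have := ih C
    exact subsingleton_succ_of_injective_embedding _ (i + 1) hf hfg hg
      fun y ↦ ⟨0, Subsingleton.elim _ _⟩

lemma exists_lTensor_gamma [IsNoetherianRing R] [Module.Flat R S] {J : Type} [AddCommGroup J]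
    [Module R J] {y : S ⊗[R] J} (hy : y ∈ gamma (I.map (algebraMap R S)) (S ⊗[R] J)) :
    ∃ z : S ⊗[R] gamma I J, (gamma I J).subtype.lTensor S z = y := by
  classical
  rw [mem_gamma_map_iff] at hy
  obtain ⟨n, hn⟩ := hy
  obtain ⟨r, a, ha⟩ := Submodule.fg_iff_exists_fin_generating_family.1
    (IsNoetherian.noetherian (I ^ n))
  let φ : J →ₗ[R] (Fin r → J) := LinearMap.pi fun k ↦ a k • LinearMap.id
  have hφ : ∀ z : S ⊗[R] J, TensorProduct.piRight R R S (fun _ : Fin r ↦ J) (φ.lTensor S z) =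
      fun k ↦ a k • z := by
    intro z
    induction z with
    | zero => ext; simp
    | add x y hx hy => rw [map_add, map_add, hx, hy]; ext k; simp
    | tmul s v => ext k; simp [φ]
  have hker : LinearMap.ker φ ≤ gamma I J := by
    intro w hw
    refine ⟨n, fun b hb ↦ ?_⟩
    rw [← ha] at hb
    induction hb using Submodule.span_induction with
    | mem b hb =>
      obtain ⟨k, rfl⟩ := hb
      exact congrFun hw k
    | zero => exact zero_smul _ _
    | add a b _ _ ha hb => rw [add_smul, ha, hb, add_zero]
    | smul s a _ ha => rw [smul_assoc, ha, smul_zero]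
  have hex : Function.Exact (LinearMap.ker φ).subtype φ := LinearMap.exact_subtype_ker_map φ
  obtain ⟨z, rfl⟩ := ((Module.Flat.lTensor_exact S hex) y).1 (by
    apply (TensorProduct.piRight R R S (fun _ : Fin r ↦ J)).injective
    rw [hφ, map_zero]
    ext k
    exact hn _ (ha ▸ Submodule.subset_span ⟨k, rfl⟩))
  refine ⟨(Submodule.inclusion hker).lTensor S z, ?_⟩
  rw [← LinearMap.comp_apply, ← LinearMap.lTensor_comp]
  rfl

/-- The half of flat base change for local cohomology that concerns vanishing. -/
theorem subsingleton_tensorProduct [IsNoetherianRing R] [Module.Flat R S] (i : ℕ) :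
    ∀ (N : Type) [AddCommGroup N] [Module R N]
      [Subsingleton (LC (I.map (algebraMap R S)) i (S ⊗[R] N))],
      Subsingleton (S ⊗[R] LC I i N) := by
  have hgam : ∀ (N : Type) [AddCommGroup N] [Module R N] (s : S) (t : LC I 0 N),
      s ⊗ₜ[R] (ev I t : N) ∈ gamma (I.map (algebraMap R S)) (S ⊗[R] N) := by
    intro N _ _ s t
    rw [mem_gamma_map_iff]
    obtain ⟨n, hn⟩ := exists_pow_smul_eq_zero I 0 t
    refine ⟨n, fun a ha ↦ ?_⟩
    rw [← TensorProduct.tmul_smul, ← map_smul, hn a ha, map_zero, TensorProduct.tmul_zero]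
  have hinj : ∀ (N : Type) [AddCommGroup N] [Module R N],
      Function.Injective ((ev I (M := N)).lTensor S) := fun N _ _ ↦
    Module.Flat.lTensor_preserves_injective_linearMap _ (ev_injective I)
  induction i with
  | zero =>
    intro N _ _ hN
    refine subsingleton_of_forall_eq 0 fun x ↦ ?_
    induction x with
    | zero => rfl
    | add x y hx hy => rw [hx, hy, add_zero]
    | tmul s t =>
      apply hinj N
      have h1 := hgam N s t
      rw [← range_ev] at h1
      obtain ⟨y, hy⟩ := h1
      rw [LinearMap.lTensor_tmul, map_zero, ← hy, Subsingleton.elim y 0, map_zero]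
  | succ i ih =>
    intro N _ _ hN
    obtain ⟨J, _, _, f, hJ, hf⟩ := Module.exists_injective_embedding (R := R) N
    let g := (LinearMap.range f).mkQ
    have hfg : Function.Exact f g := LinearMap.exact_map_mkQ_range f
    have hg : Function.Surjective g := Submodule.mkQ_surjective _
    let f' := AlgebraTensorModule.lTensor S S f
    let g' := AlgebraTensorModule.lTensor S S g
    have hf' : Function.Injective f' :=
      Module.Flat.lTensor_preserves_injective_linearMap (M := S) f hf
    have hg' : Function.Surjective g' := LinearMap.lTensor_surjective S hg
    have hfg' : Function.Exact f' g' := Module.Flat.lTensor_exact S hfg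
    have hJS : Module.Injective R (S ⊗[R] J) := Module.injective_tensorProduct J
    obtain ⟨δ, h1, h2⟩ := exists_connecting I i hf hfg hg
    obtain ⟨δ', h1', h2'⟩ := exists_connecting (I.map (algebraMap R S)) i hf' hfg' hg'
    have hδ : Function.Surjective δ := fun t ↦
      (h2 t).1 ((subsingleton_of_injective I i J).elim _ _)
    have hmap' : Function.Surjective (map (I.map (algebraMap R S)) i g') := fun y ↦
      (h1' y).1 (Subsingleton.elim _ _)
    have hmap : Function.Surjective ((map I i g).lTensor S) := by
      cases i with
      | zero =>
        intro x
        induction x with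
        | zero => exact ⟨0, map_zero _⟩
        | add x y hx hy =>
          obtain ⟨x, rfl⟩ := hx
          obtain ⟨y, rfl⟩ := hy
          exact ⟨x + y, map_add _ _ _⟩
        | tmul s t =>
          have h3 := hgam _ s t
          rw [← range_ev] at h3
          obtain ⟨y, hy⟩ := h3
          obtain ⟨x, rfl⟩ := hmap' y
          rw [ev_map] at hy
          obtain ⟨z, hz⟩ := exists_lTensor_gamma I (J := J)
            (y := ev (I.map (algebraMap R S)) x) (by rw [← range_ev]; exact ⟨x, rfl⟩)
          let ε : LC I 0 J →ₗ[R] gamma I J := (ev I).codRestrict _ fun t ↦ by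
            rw [← range_ev]; exact ⟨t, rfl⟩
          have hε : Function.Surjective ε := by
            rintro ⟨w, hw⟩
            rw [← range_ev] at hw
            obtain ⟨w, rfl⟩ := hw
            exact ⟨w, rfl⟩
          obtain ⟨z, rfl⟩ := LinearMap.lTensor_surjective S hε z
          refine ⟨z, hinj _ ?_⟩
          rw [LinearMap.lTensor_tmul, ← hy, ← hz]
          change _ = g.lTensor S _
          rw [← LinearMap.comp_apply, ← LinearMap.comp_apply, ← LinearMap.comp_apply,
            ← LinearMap.lTensor_comp, ← LinearMap.lTensor_comp, ← LinearMap.lTensor_comp]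
          congr 2
          ext t
          exact ev_map I g t
      | succ i =>
        have := subsingleton_of_injective_restrictScalars (S := S) I i (S ⊗[R] J)
        have : Subsingleton (LC (I.map (algebraMap R S)) (i + 1)
          (S ⊗[R] (J ⧸ LinearMap.range f))) := hmap'.subsingleton
        have := ih (J ⧸ LinearMap.range f)
        exact fun y ↦ ⟨0, Subsingleton.elim _ _⟩
    refine subsingleton_of_forall_eq 0 fun t ↦ ?_
    obtain ⟨t, rfl⟩ := LinearMap.lTensor_surjective S hδ t
    obtain ⟨t, rfl⟩ := hmap t
    rw [← LinearMap.comp_apply, ← LinearMap.lTensor_comp]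
    have : δ ∘ₗ map I i g = 0 := by
      ext x
      exact (h1 _).2 ⟨x, rfl⟩
    rw [this, LinearMap.lTensor_zero, LinearMap.zero_apply]

end LocalCohomologyAux

section InjectiveHull

variable {R : Type} [CommRing R]

lemma zorn_submodule {M : Type} [AddCommGroup M] [Module R M] (p : Submodule R M → Prop)
    (hp : ∀ c : Set (Submodule R M), c.Nonempty → (∀ A ∈ c, p A) → IsChain (· ≤ ·) c →
      (∀ x, x ∈ sSup c ↔ ∃ A ∈ c, x ∈ A) → p (sSup c)) (A₀ : Submodule R M) (h₀ : p A₀) :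
    ∃ A, A₀ ≤ A ∧ p A ∧ ∀ B, A ≤ B → p B → B ≤ A := by
  obtain ⟨A, hA₀, hA⟩ := zorn_le_nonempty₀ {A | p A} (fun c hc hchain y hy ↦
    ⟨sSup c, hp c ⟨y, hy⟩ hc hchain fun x ↦
      Submodule.mem_sSup_of_directed ⟨y, hy⟩ hchain.directedOn,
      fun z hz ↦ le_sSup hz⟩) A₀ h₀
  exact ⟨A, hA₀, hA.prop, fun B hAB hB ↦ hA.le_of_ge hB hAB⟩

/-- Every submodule of an injective module has an injective hull inside it. -/
theorem Submodule.exists_injective_essential {J : Type} [AddCommGroup J] [Module R J]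
    [Module.Injective R J] (K : Submodule R J) :
    ∃ E : Submodule R J, K ≤ E ∧ Module.Injective R E ∧
      ∀ x ∈ E, x ≠ 0 → ∃ r : R, r • x ∈ K ∧ r • x ≠ 0 := by
  obtain ⟨E, hKE, hE, hmax⟩ := zorn_submodule
    (fun A : Submodule R J ↦ ∀ x ∈ A, x ≠ 0 → ∃ r : R, r • x ∈ K ∧ r • x ≠ 0)
    (fun c _ hc _ hmem x hx hx0 ↦ by
      obtain ⟨A, hA, hxA⟩ := (hmem x).1 hx
      exact hc A hA x hxA hx0) K (fun x hx hx0 ↦ ⟨1, by simpa using hx, by simpa using hx0⟩)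
  obtain ⟨C, -, hC, hCmax⟩ := zorn_submodule
    (fun A : Submodule R J ↦ ∀ x ∈ A, x ∈ E → x = 0)
    (fun c _ hc _ hmem x hx hxE ↦ by
      obtain ⟨A, hA, hxA⟩ := (hmem x).1 hx
      exact hc A hA x hxA hxE) ⊥ (fun x hx _ ↦ hx)
  have hi : Function.Injective (C.mkQ ∘ₗ E.subtype) := by
    rw [← LinearMap.ker_eq_bot, LinearMap.ker_eq_bot']
    rintro ⟨x, hx⟩ h
    exact Subtype.ext (hC x ((Submodule.Quotient.mk_eq_zero _).1 h) hx)
  obtain ⟨ψ, hψ⟩ := Module.Injective.out (C.mkQ ∘ₗ E.subtype) hi E.subtype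
  have hψ' : ∀ e ∈ E, ψ (C.mkQ e) = e := fun e he ↦ hψ ⟨e, he⟩
  have hrange : LinearMap.range ψ ≤ E := by
    refine hmax _ (fun e he ↦ ⟨C.mkQ e, hψ' e he⟩) ?_
    rintro _ ⟨y, rfl⟩ hy0
    obtain ⟨x, rfl⟩ := C.mkQ_surjective y
    have hmkQ : ∀ {c}, c ∈ C → C.mkQ c = 0 := fun hc ↦ (Submodule.Quotient.mk_eq_zero C).2 hc
    have hx : x ∉ C := fun hx ↦ hy0 (by rw [hmkQ hx, map_zero])
    have : ∃ z ∈ C ⊔ Submodule.span R {x}, z ∈ E ∧ z ≠ 0 := by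
      by_contra! hcon
      exact hx (hCmax (C ⊔ Submodule.span R {x}) le_sup_left
        (fun z hz hzE ↦ hcon z hz hzE)
        (Submodule.mem_sup_right (Submodule.mem_span_singleton_self x)))
    obtain ⟨z, hz, hzE, hz0⟩ := this
    obtain ⟨c, hc, w, hw, rfl⟩ := Submodule.mem_sup.1 hz
    obtain ⟨r, rfl⟩ := Submodule.mem_span_singleton.1 hw
    have hr : r • ψ (C.mkQ x) = c + r • x := by
      rw [← hψ' _ hzE, map_add C.mkQ, hmkQ hc, zero_add, map_smul, map_smul]
    obtain ⟨s, hs, hs0⟩ := hE _ hzE hz0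
    exact ⟨s * r, by rwa [mul_smul, hr], by rwa [mul_smul, hr]⟩
  refine ⟨E, hKE, ⟨fun X Y _ _ _ _ i hi φ ↦ ?_⟩, hE⟩
  obtain ⟨h, hh⟩ := Module.Injective.out i hi (E.subtype ∘ₗ φ)
  refine ⟨(ψ.codRestrict E fun y ↦ hrange ⟨y, rfl⟩) ∘ₗ C.mkQ ∘ₗ h, fun x ↦ Subtype.ext ?_⟩
  simp only [LinearMap.comp_apply, LinearMap.codRestrict_apply, hh]
  exact hψ' _ (φ x).2

/-- A local ring has an injective module whose socle is simple. -/
theorem IsLocalRing.exists_injective_socle (R : Type) [CommRing R] [IsLocalRing R] :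
    ∃ (E : Type) (_ : AddCommGroup E) (_ : Module R E) (e : E), Module.Injective R E ∧ e ≠ 0 ∧
      (∀ a ∈ IsLocalRing.maximalIdeal R, a • e = 0) ∧
      ∀ x : E, (∀ a ∈ IsLocalRing.maximalIdeal R, a • x = 0) → ∃ r : R, x = r • e := by
  obtain ⟨J, _, _, f, hJ, hf⟩ :=
    Module.exists_injective_embedding (R := R) (R ⧸ IsLocalRing.maximalIdeal R)
  obtain ⟨E, hE, hEinj, hess⟩ := Submodule.exists_injective_essential (LinearMap.range f)
  have hfmk : ∀ y, ∃ r : R, f y = r • f 1 := by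
    intro y
    obtain ⟨r, rfl⟩ := Ideal.Quotient.mk_surjective y
    refine ⟨r, ?_⟩
    rw [← map_smul, Algebra.smul_def, mul_one]
    rfl
  refine ⟨E, inferInstance, inferInstance, ⟨f 1, hE ⟨1, rfl⟩⟩, hEinj, ?_, ?_, ?_⟩
  · intro h
    have : f 1 = 0 := congrArg Subtype.val h
    rw [map_eq_zero_iff f hf] at this
    exact one_ne_zero this
  · intro a ha
    refine Subtype.ext ?_
    change a • f 1 = 0
    rw [← map_smul, Algebra.smul_def, mul_one]
    rw [Ideal.Quotient.algebraMap_eq, Ideal.Quotient.eq_zero_iff_mem.2 ha, map_zero]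
  · intro x hx
    by_cases hx0 : x = 0
    · exact ⟨0, by rw [hx0, zero_smul]⟩
    obtain ⟨r, ⟨y, hy⟩, hr0⟩ := hess x x.2 (fun h ↦ hx0 (Subtype.ext h))
    have hru : IsUnit r := by
      by_contra hr
      exact hr0 (congrArg Subtype.val (hx r ((IsLocalRing.mem_maximalIdeal r).2 hr)))
    obtain ⟨u, rfl⟩ := hru
    obtain ⟨s, hs⟩ := hfmk y
    refine ⟨(↑u⁻¹ : R) * s, Subtype.ext ?_⟩
    change (x : J) = ((↑u⁻¹ : R) * s) • f 1
    rw [mul_smul, ← hs, hy, ← mul_smul, Units.inv_mul, one_smul]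

end InjectiveHull

section Duality

variable {R : Type} [CommRing R] {E A B C : Type} [AddCommGroup E] [Module R E]
  [AddCommGroup A] [Module R A] [AddCommGroup B] [Module R B] [AddCommGroup C] [Module R C]
  {f : A →ₗ[R] B} {g : B →ₗ[R] C}

lemma Module.Injective.exists_comp_eq_of_comp_eq_zero [Module.Injective R E]
    (h : Function.Exact f g) (φ : B →ₗ[R] E) (hφ : φ ∘ₗ f = 0) : ∃ ψ : C →ₗ[R] E, ψ ∘ₗ g = φ := by
  have hk : LinearMap.ker g ≤ LinearMap.ker φ := by
    intro b hb
    obtain ⟨a, rfl⟩ := (h b).1 hb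
    exact LinearMap.congr_fun hφ a
  have hi : Function.Injective ((LinearMap.ker g).liftQ g le_rfl) :=
    LinearMap.ker_eq_bot.1 (Submodule.ker_liftQ_eq_bot _ _ _ le_rfl)
  obtain ⟨ψ, hψ⟩ := Module.Injective.out _ hi ((LinearMap.ker g).liftQ φ hk)
  exact ⟨ψ, LinearMap.ext fun b ↦ hψ (Submodule.Quotient.mk b)⟩

lemma Module.Injective.range_lcomp_eq_ker_lcomp [Module.Injective R E]
    (h : Function.Exact f g) :
    LinearMap.range (LinearMap.lcomp R E g) = LinearMap.ker (LinearMap.lcomp R E f) := by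
  ext φ
  rw [LinearMap.mem_range, LinearMap.mem_ker]
  constructor
  · rintro ⟨ψ, rfl⟩
    ext a
    change ψ (g (f a)) = 0
    rw [h.apply_apply_eq_zero, map_zero]
  · exact fun hφ ↦ Module.Injective.exists_comp_eq_of_comp_eq_zero h φ hφ

lemma Module.Injective.exists_dual_ne_zero [IsLocalRing R] [Module.Injective R E] {e : E}
    (he : e ≠ 0) (hme : ∀ a ∈ IsLocalRing.maximalIdeal R, a • e = 0) {y : A} (hy : y ≠ 0) {n : ℕ}
    (hn : ∀ a ∈ IsLocalRing.maximalIdeal R ^ n, a • y = 0) : ∃ φ : A →ₗ[R] E, φ y ≠ 0 := by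
  induction n generalizing y with
  | zero => exact absurd (by simpa using hn 1 (by simp)) hy
  | succ n ih =>
    by_cases h : ∀ a ∈ IsLocalRing.maximalIdeal R, a • y = 0
    · have hk : ∀ {X : Type} [AddCommGroup X] [Module R X] (x : X),
          (∀ a ∈ IsLocalRing.maximalIdeal R, a • x = 0) →
          IsLocalRing.maximalIdeal R ≤ LinearMap.ker (LinearMap.toSpanSingleton R X x) :=
        fun x hx a ha ↦ by simpa using hx a ha
      let ι := Submodule.liftQ _ _ (hk y h)
      have hι : Function.Injective ι := by
        refine LinearMap.ker_eq_bot.1 (Submodule.ker_liftQ_eq_bot _ _ _ fun r hr ↦ ?_)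
        rw [IsLocalRing.mem_maximalIdeal, mem_nonunits_iff]
        intro hu
        rw [LinearMap.mem_ker, LinearMap.toSpanSingleton_apply] at hr
        exact hy ((hu.smul_eq_zero).1 hr)
      obtain ⟨φ, hφ⟩ := Module.Injective.out ι hι (Submodule.liftQ _ _ (hk e hme))
      have h1 := hφ (Submodule.Quotient.mk 1)
      simp only [ι, Submodule.liftQ_apply, LinearMap.toSpanSingleton_apply, one_smul] at h1
      exact ⟨φ, by rwa [h1]⟩
    · push Not at h
      obtain ⟨a, ha, hay⟩ := h
      obtain ⟨φ, hφ⟩ := ih hay fun b hb ↦ by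
        rw [← mul_smul]
        exact hn _ (by rw [pow_succ]; exact Ideal.mul_mem_mul hb ha)
      exact ⟨φ, fun h0 ↦ hφ (by rw [map_smul, h0, smul_zero])⟩

/-- A separated module over a complete ring is finite as soon as it is finite modulo an element
of the ideal. -/
theorem Module.Finite.of_isAdicComplete_of_smul [IsNoetherianRing R] (m : Ideal R)
    [IsAdicComplete m R] {x : R} (hx : x ∈ m)
    (hA : ∀ y : A, (∀ n, y ∈ m ^ n • (⊤ : Submodule R A)) → y = 0)
    (s : A →ₗ[R] B) [IsNoetherian R B] (hs : ∀ y, s y = 0 → ∃ z, y = x • z) :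
    Module.Finite R A := by
  obtain ⟨t, ht⟩ := IsNoetherian.noetherian (LinearMap.range s)
  have hg : ∀ b : t, ∃ a, s a = b := fun b ↦ by
    have : (b : B) ∈ LinearMap.range s := ht ▸ Submodule.subset_span b.2
    exact this
  choose d hd using hg
  have key : ∀ y : A, ∃ (c : t → R) (z : A), y = ∑ k, c k • d k + x • z := by
    intro y
    have hy : s y ∈ Submodule.span R (Set.range ((↑) : t → B)) := by
      rw [Subtype.range_coe_subtype, Finset.setOfPred_mem, ht]
      exact ⟨y, rfl⟩
    obtain ⟨c, hc⟩ := (Submodule.mem_span_range_iff_exists_fun R).1 hy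
    obtain ⟨z, hz⟩ := hs (y - ∑ k, c k • d k) (by
      rw [map_sub, map_sum, ← hc, sub_eq_zero]
      exact Finset.sum_congr rfl fun k _ ↦ by rw [map_smul, hd])
    exact ⟨c, z, by rw [← hz, add_sub_cancel]⟩
  choose c z hcz using key
  refine ⟨Submodule.fg_def.2 ⟨Set.range d, Set.finite_range d, eq_top_iff.2 fun y _ ↦ ?_⟩⟩
  have hL : ∀ k, ∃ L : R, ∀ i, L - ∑ j ∈ Finset.range i, x ^ j * c (z^[j] y) k ∈ m ^ (i - 0) :=
    fun k ↦ IsAdicComplete.exists_sum_limit m 0 _ fun i ↦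
      Ideal.mul_mem_right _ _ (Ideal.pow_mem_pow hx i)
  choose L hL using hL
  have hy : ∀ i, y = ∑ k, (∑ j ∈ Finset.range i, x ^ j * c (z^[j] y) k) • d k +
      x ^ i • z^[i] y := by
    intro i
    induction i with
    | zero => simp
    | succ i ih =>
      conv_lhs => rw [ih, hcz (z^[i] y)]
      simp only [Finset.sum_range_succ, add_smul, Finset.sum_add_distrib, smul_add,
        Finset.smul_sum, mul_smul, Function.iterate_succ_apply', pow_succ, add_assoc]
  have : y = ∑ k, L k • d k := by
    rw [← sub_eq_zero]
    refine hA _ fun i ↦ ?_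
    nth_rw 1 [hy i]
    rw [add_sub_right_comm, ← Finset.sum_sub_distrib]
    refine add_mem (sum_mem fun k _ ↦ ?_)
      (Submodule.smul_mem_smul (Ideal.pow_mem_pow hx i) trivial)
    rw [← sub_smul, ← neg_mem_iff, ← neg_smul, neg_sub]
    exact Submodule.smul_mem_smul (hL k i) trivial
  rw [this]
  exact sum_mem fun k _ ↦ Submodule.smul_mem _ _ (Submodule.subset_span ⟨k, rfl⟩)

end Duality

namespace LocalCohomologyAux

open IsLocalRing

lemma mem_gamma_of_smul_mem {R : Type} [CommRing R] {T : Type} [AddCommGroup T] [Module R T]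
    {m : Ideal R} (hm : m.FG) {t : T} (n : ℕ)
    (h : ∀ a ∈ m ^ n, a • t ∈ gamma m T) : t ∈ gamma m T := by
  obtain ⟨k, hk⟩ := exists_pow_smul_le_of_fg m
    (B := Submodule.map (LinearMap.toSpanSingleton R T t) (m ^ n))
    (Submodule.FG.map _ (Ideal.FG.pow hm)) (by
      rintro _ ⟨a, ha, rfl⟩
      exact h a ha)
  refine ⟨k + n, fun a ha ↦ ?_⟩
  rw [pow_add] at ha
  refine Submodule.mul_induction_on ha (fun a ha b hb ↦ ?_) fun a b ha hb ↦ ?_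
  · rw [mul_smul]
    exact hk a ha _ ⟨b, hb, rfl⟩
  · rw [add_smul, ha, hb, add_zero]

variable {R : Type} [CommRing R] [IsLocalRing R] (I : Ideal R) (E : Type) [AddCommGroup E]
  [Module R E]

/-- A module that is torsion at the maximal ideal, with finite dual, and killed by an element
outside each nonmaximal prime containing `I`. -/
structure IsDualFinite (T : Type) [AddCommGroup T] [Module R T] : Prop where
  torsion : ∀ t : T, t ∈ gamma (maximalIdeal R) T
  noetherian : IsNoetherian R (T →ₗ[R] E)
  exists_smul : ∀ P : Ideal R, P.IsPrime → I ≤ P → P ≠ maximalIdeal R → ∃ s ∉ P, ∀ t : T, s • t = 0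

variable {E} {T A B C : Type} [AddCommGroup T] [Module R T]
  [AddCommGroup A] [Module R A] [AddCommGroup B] [Module R B] [AddCommGroup C] [Module R C]

namespace IsDualFinite

lemma of_subsingleton [Subsingleton T] : IsDualFinite I E T where
  torsion t := by rw [Subsingleton.elim t 0]; exact zero_mem _
  noetherian := inferInstance
  exists_smul P hP _ _ := ⟨1, hP.one_notMem, fun _ ↦ Subsingleton.elim _ _⟩

variable {I} in
lemma of_equiv_quotient [IsNoetherianRing R] {e : E}
    (he : ∀ x : E, (∀ a ∈ maximalIdeal R, a • x = 0) → ∃ r : R, x = r • e)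
    (f : A ≃ₗ[R] R ⧸ maximalIdeal R) : IsDualFinite I E A := by
  have hA : ∀ a ∈ maximalIdeal R, ∀ y : A, a • y = 0 := fun a ha y ↦ by
    apply f.injective
    obtain ⟨r, hr⟩ := Ideal.Quotient.mk_surjective (f y)
    rw [map_smul, map_zero, ← hr, ← Ideal.Quotient.mk_eq_mk, ← Submodule.Quotient.mk_smul,
      Submodule.Quotient.mk_eq_zero]
    exact Ideal.mul_mem_right _ _ ha
  have hgen : ∀ y : A, ∃ r : R, y = r • f.symm 1 := fun y ↦ by
    obtain ⟨r, hr⟩ := Ideal.Quotient.mk_surjective (f y)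
    refine ⟨r, f.injective ?_⟩
    rw [map_smul, f.apply_symm_apply, ← hr, Algebra.smul_def, mul_one]
    rfl
  refine ⟨fun t ↦ ⟨1, fun a ha ↦ hA a (by simpa using ha) t⟩, ?_, fun P hP _ hPm ↦ ?_⟩
  · let ev : (A →ₗ[R] E) →ₗ[R] E := LinearMap.applyₗ (f.symm 1)
    have h1 : ∀ φ, ev φ ∈ Submodule.span R {e} := fun φ ↦ by
      obtain ⟨r, hr⟩ := he (ev φ) fun a ha ↦ by
        change a • φ (f.symm 1) = 0
        rw [← map_smul, hA a ha, map_zero]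
      exact Submodule.mem_span_singleton.2 ⟨r, hr.symm⟩
    have : IsNoetherian R (Submodule.span R {e}) :=
      isNoetherian_span_of_finite R (Set.finite_singleton e)
    refine isNoetherian_of_injective (ev.codRestrict _ h1) fun φ ψ h ↦ ?_
    ext y
    obtain ⟨r, rfl⟩ := hgen y
    rw [map_smul, map_smul]
    exact congrArg _ (congrArg Subtype.val h)
  · obtain ⟨s, hs, hsP⟩ := SetLike.not_le_iff_exists.1 (fun h : maximalIdeal R ≤ P ↦
      hPm (le_antisymm (le_maximalIdeal hP.ne_top) h))
    exact ⟨s, hsP, hA s hs⟩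

variable {I} [IsNoetherianRing R] [Module.Injective R E]

lemma of_exact {f : A →ₗ[R] B} {g : B →ₗ[R] C} (h : Function.Exact f g)
    (hA : IsDualFinite I E A) (hC : IsDualFinite I E C) : IsDualFinite I E B where
  torsion b := by
    obtain ⟨n, hn⟩ := hC.torsion (g b)
    refine mem_gamma_of_smul_mem (IsNoetherian.noetherian _) n fun r hr ↦ ?_
    obtain ⟨a, ha⟩ := (h (r • b)).1 (by rw [map_smul, hn r hr])
    obtain ⟨k, hk⟩ := hA.torsion a
    exact ⟨k, fun s hs ↦ by rw [← ha, ← map_smul, hk s hs, map_zero]⟩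
  noetherian := by
    have := hA.noetherian
    have := hC.noetherian
    exact isNoetherian_of_range_eq_ker _ _ (Module.Injective.range_lcomp_eq_ker_lcomp (E := E) h)
  exists_smul P hP hIP hPm := by
    obtain ⟨s, hs, hsA⟩ := hA.exists_smul P hP hIP hPm
    obtain ⟨r, hr, hrC⟩ := hC.exists_smul P hP hIP hPm
    refine ⟨s * r, hP.mul_notMem hs hr, fun b ↦ ?_⟩
    obtain ⟨a, ha⟩ := (h (r • b)).1 (by rw [map_smul, hrC])
    rw [mul_smul, ← ha, ← map_smul, hsA, map_zero]

lemma of_injective {f : A →ₗ[R] B} (h : Function.Injective f) (hB : IsDualFinite I E B) :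
    IsDualFinite I E A :=
  have : Function.Exact (0 : PUnit →ₗ[R] A) f := fun a ↦ by
    rw [map_eq_zero_iff f h]
    exact ⟨fun h ↦ ⟨0, by rw [h, map_zero]⟩, by rintro ⟨_, rfl⟩; rfl⟩
  of_exact this (of_subsingleton I) hB

/-- The inductive step: multiplication by `x` on `B` has a kernel that is a quotient of a module
with finite dual. -/
lemma of_exact_smul [IsAdicComplete (maximalIdeal R) R] {e : E} (he : e ≠ 0)
    (hme : ∀ a ∈ maximalIdeal R, a • e = 0) {x : R} (hxI : x ∈ I) {δ : A →ₗ[R] B}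
    (h : Function.Exact δ (LinearMap.lsmul R B x)) (hx : ∀ b : B, ∃ n : ℕ, x ^ n • b = 0)
    {q : Ideal R} (hq : ∀ a ∈ q, ∀ b : B, a • b = 0)
    (hA : IsDualFinite I E A) : IsDualFinite I E B := by
  have tors : ∀ b : B, b ∈ gamma (maximalIdeal R) B := fun b ↦ by
    obtain ⟨n, hn⟩ := hx b
    induction n generalizing b with
    | zero =>
      rw [pow_zero, one_smul] at hn
      rw [hn]
      exact zero_mem _
    | succ n ih =>
      obtain ⟨a, ha⟩ := (h (x ^ n • b)).1 (by
        rwa [LinearMap.lsmul_apply, ← mul_smul, ← pow_succ'])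
      obtain ⟨k, hk⟩ := hA.torsion a
      refine mem_gamma_of_smul_mem (IsNoetherian.noetherian _) k fun r hr ↦ ih _ ?_
      rw [smul_comm, ← ha, ← map_smul, hk r hr, map_zero]
  by_cases hxm : x ∈ maximalIdeal R
  swap
  · have : Subsingleton B := subsingleton_of_forall_eq 0 fun b ↦ by
      obtain ⟨n, hn⟩ := hx b
      exact ((not_not.1 hxm).pow n).smul_eq_zero.1 hn
    exact of_subsingleton I
  have hdiv : ∀ φ : B →ₗ[R] E, φ ∘ₗ δ = 0 → ∃ ψ : B →ₗ[R] E, φ = x • ψ := fun φ hφ ↦ by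
    obtain ⟨ψ, hψ⟩ := Module.Injective.exists_comp_eq_of_comp_eq_zero h φ hφ
    refine ⟨ψ, ?_⟩
    rw [← hψ]
    ext b
    exact map_smul ψ x b
  have hfin : Module.Finite R (B →ₗ[R] E) := by
    have := hA.noetherian
    refine Module.Finite.of_isAdicComplete_of_smul (maximalIdeal R) hxm (fun φ hφ ↦ ?_)
      (LinearMap.lcomp R E δ) hdiv
    ext b
    obtain ⟨n, hn⟩ := tors b
    have : ∀ ψ ∈ maximalIdeal R ^ n • (⊤ : Submodule R (B →ₗ[R] E)), ψ b = 0 := fun ψ hψ ↦ by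
      refine Submodule.smul_induction_on hψ (fun a ha θ _ ↦ ?_) fun θ₁ θ₂ h₁ h₂ ↦ ?_
      · rw [LinearMap.smul_apply, ← map_smul, hn a ha, map_zero]
      · rw [LinearMap.add_apply, h₁, h₂, add_zero]
    exact this φ (hφ n)
  refine ⟨tors, inferInstance, fun P hP hIP hPm ↦ ?_⟩
  by_cases hqP : q ≤ P
  swap
  · obtain ⟨s, hs, hsP⟩ := SetLike.not_le_iff_exists.1 hqP
    exact ⟨s, hsP, hq s hs⟩
  obtain ⟨s, hsP, hs⟩ := hA.exists_smul P hP hIP hPm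
  obtain ⟨p, hp, -, hcoeff, hp0⟩ :=
    LinearMap.exists_monic_and_natDegree_eq_and_coeff_mem_pow_and_aeval_eq_zero R
      (algebraMap R (Module.End R (B →ₗ[R] E)) s) (Ideal.span {x}) (by
        rintro _ ⟨φ, rfl⟩
        rw [Module.algebraMap_end_apply]
        obtain ⟨ψ, hψ⟩ := hdiv (s • φ) (by
          ext a
          change (s • φ) (δ a) = 0
          rw [LinearMap.smul_apply, ← map_smul, ← map_smul, hs, map_zero, map_zero])
        rw [hψ]
        exact Submodule.smul_mem_smul (Ideal.mem_span_singleton_self x) trivial)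
  rw [Polynomial.aeval_algebraMap_apply] at hp0
  refine ⟨Polynomial.aeval s p, ?_, fun b ↦ ?_⟩
  · intro hmem
    rw [Polynomial.aeval_eq_sum_range, Finset.sum_range_succ, hp.coeff_natDegree, one_smul,
      add_mem_cancel_left (sum_mem fun k hk ↦ ?_)] at hmem
    · exact hsP (hP.mem_of_pow_mem _ hmem)
    · have h1 := Ideal.pow_le_self (Nat.sub_ne_zero_of_lt (Finset.mem_range.1 hk)) (hcoeff k)
      exact P.mul_mem_right _ ((Ideal.span_singleton_le_iff_mem P).2 (hIP hxI) h1)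
  · by_contra hb
    obtain ⟨n, hn⟩ := tors (Polynomial.aeval s p • b)
    obtain ⟨φ, hφ⟩ := Module.Injective.exists_dual_ne_zero he hme hb hn
    apply hφ
    rw [map_smul]
    have := LinearMap.congr_fun (LinearMap.congr_fun hp0 φ) b
    exact this

end IsDualFinite
end LocalCohomologyAux

namespace LocalCohomologyAux

open IsLocalRing

variable {R : Type} [CommRing R] [IsLocalRing R] [IsNoetherianRing R] (I : Ideal R)

lemma smul_eq_zero_of_equiv_quotient {R : Type} [CommRing R] {I : Ideal R} {i : ℕ} {M : Type}
    [AddCommGroup M] [Module R M] {q : Ideal R} (f : M ≃ₗ[R] R ⧸ q) {a : R} (ha : a ∈ q)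
    (t : LC I i M) : a • t = 0 := by
  have h0 : LinearMap.lsmul R M a = 0 := by
    ext m
    apply f.injective
    obtain ⟨r, hr⟩ := Ideal.Quotient.mk_surjective (f m)
    rw [LinearMap.lsmul_apply, map_smul, LinearMap.zero_apply, map_zero, ← hr,
      ← Ideal.Quotient.mk_eq_mk, ← Submodule.Quotient.mk_smul, Submodule.Quotient.mk_eq_zero]
    exact Ideal.mul_mem_right _ _ ha
  rw [← map_toLinearMap_smul, h0, map_zero_apply]

lemma asIdeal_eq_maximalIdeal_of_ringKrullDim_le_zero {R : Type} [CommRing R] [IsLocalRing R]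
    {p : PrimeSpectrum R}
    (hp : ringKrullDim (R ⧸ p.asIdeal) ≤ 0) : p.asIdeal = maximalIdeal R := by
  have : Ring.KrullDimLE 0 (R ⧸ p.asIdeal) := Ring.krullDimLE_iff.2 hp
  have := Ideal.isMaximal_of_isPrime (⊥ : Ideal (R ⧸ p.asIdeal))
  have := Ideal.comap_isMaximal_of_surjective (Ideal.Quotient.mk p.asIdeal)
    Ideal.Quotient.mk_surjective (K := ⊥)
  rw [← RingHom.ker_eq_comap_bot, Ideal.mk_ker] at this
  exact eq_maximalIdeal this

variable {E : Type} [AddCommGroup E] [Module R E] [Module.Injective R E]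
  [IsAdicComplete (maximalIdeal R) R] {e : E}

theorem isDualFinite_of_supportDim_le (he : e ≠ 0)
    (hme : ∀ a ∈ maximalIdeal R, a • e = 0)
    (hsoc : ∀ x : E, (∀ a ∈ maximalIdeal R, a • x = 0) → ∃ r : R, x = r • e) (c : ℕ) :
    ∀ (M : Type) [AddCommGroup M] [Module R M] [Module.Finite R M],
      Module.supportDim R M ≤ c → IsDualFinite I E (LC I c M) := by
  induction c with
  | zero =>
    intro M _ _ _ h
    refine IsDualFinite.of_injective (ev_injective I) ?_
    refine Module.prime_filtration_induction
      {p : PrimeSpectrum R | ringKrullDim (R ⧸ p.asIdeal) ≤ 0}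
      (fun M _ _ ↦ IsDualFinite I E M) ?_ ?_ ?_ M ?_
    · intro M _ _ _
      exact IsDualFinite.of_subsingleton I
    · intro M _ _ p hp f
      rw [asIdeal_eq_maximalIdeal_of_ringKrullDim_le_zero hp] at f
      exact IsDualFinite.of_equiv_quotient hsoc f
    · intro A B C _ _ _ _ _ _ f g hf hfg hg hA hC
      exact IsDualFinite.of_exact hfg hA hC
    · intro p hp
      exact (ringKrullDim_quotient_le_supportDim hp).trans h
  | succ c ih =>
    intro M _ _ _ h
    refine Module.prime_filtration_induction
      {p : PrimeSpectrum R | ringKrullDim (R ⧸ p.asIdeal) ≤ (c + 1 : ℕ)}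
      (fun M _ _ ↦ IsDualFinite I E (LC I (c + 1) M)) ?_ ?_ ?_ M ?_
    · intro M _ _ _
      have := subsingleton_of_subsingleton I (c + 1) M
      exact IsDualFinite.of_subsingleton I
    · intro M _ _ p hp f
      by_cases hI : I ≤ p.asIdeal
      · have := subsingleton_succ_of_equiv_quotient I c hI f
        exact IsDualFinite.of_subsingleton I
      · obtain ⟨x, hxI, hxp⟩ := SetLike.not_le_iff_exists.1 hI
        have : Module.Finite R M := Module.Finite.equiv f.symm
        obtain ⟨δ, hδ⟩ := exists_quotSMulTop_connecting I c (isSMulRegular_of_equiv_quotient f hxp)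
        refine IsDualFinite.of_exact_smul he hme hxI hδ (exists_pow_smul_eq_zero_of_mem I _ hxI)
          (fun a ha t ↦ smul_eq_zero_of_equiv_quotient f ha t) (ih (QuotSMulTop x M) ?_)
        have h1 := Module.supportDim_quotSMulTop_lt f hxp
        rw [Module.supportDim_eq_of_equiv f, Module.supportDim_quotient_eq_ringKrullDim] at h1
        have h2 := h1.trans hp
        push_cast at h2 ⊢
        exact ENat.WithBot.add_le_add_one_right_iff.1 h2
    · intro A B C _ _ _ _ _ _ f g hf hfg hg hA hC
      exact IsDualFinite.of_exact (map_exact I _ hf hfg hg) hA hC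
    · intro p hp
      exact (ringKrullDim_quotient_le_supportDim hp).trans h

/-- A form of the Lichtenbaum–Hartshorne vanishing theorem. -/
theorem exists_radical_sup_eq_maximalIdeal (c : ℕ) (M : Type) [AddCommGroup M] [Module R M]
    [Module.Finite R M] (hM : Module.supportDim R M ≤ c) (h : ¬ Subsingleton (LC I c M)) :
    ∃ q ∈ associatedPrimes R M, (∀ q' ∈ associatedPrimes R M, q' ≤ q → q' = q) ∧
      (I ⊔ q).radical = maximalIdeal R := by
  obtain ⟨E, _, _, e, _, he, hme, hsoc⟩ := IsLocalRing.exists_injective_socle R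
  by_contra! hcon
  apply h
  refine Module.prime_filtration_induction (Module.support R M)
      (fun M _ _ ↦ Subsingleton (LC I c M)) ?_ ?_ ?_ M subset_rfl
  · intro A _ _ _
    exact subsingleton_of_subsingleton I c A
  · intro A _ _ p hp f
    have hAfin : Module.Finite R A := Module.Finite.equiv f.symm
    have hdimA : Module.supportDim R A = ringKrullDim (R ⧸ p.asIdeal) := by
      rw [Module.supportDim_eq_of_equiv f, Module.supportDim_quotient_eq_ringKrullDim]
    have hle : Module.supportDim R A ≤ c :=
      hdimA.trans_le ((ringKrullDim_quotient_le_supportDim hp).trans hM)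
    obtain hlt | heq := hle.lt_or_eq
    · exact subsingleton_of_supportDim_lt I c A hlt
    have hmin : ∀ p' ∈ Module.support R M, p' ≤ p → p' = p := by
      intro p' hp' hle'
      by_contra hne
      obtain ⟨x, hxp, hxp'⟩ := SetLike.not_le_iff_exists.1
        (fun h : p.asIdeal ≤ p'.asIdeal ↦ hne (le_antisymm hle' h))
      have h1 := Module.supportDim_quotSMulTop_lt (LinearEquiv.refl R (R ⧸ p'.asIdeal)) hxp'
      rw [Module.supportDim_quotient_eq_ringKrullDim] at h1
      have h2 : p ∈ Module.support R (QuotSMulTop x (R ⧸ p'.asIdeal)) := by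
        rw [Module.support_quotSMulTop, Module.support_eq_zeroLocus, Ideal.annihilator_quotient]
        exact ⟨hle', by simpa using hxp⟩
      have h3 := (add_le_add_left (ringKrullDim_quotient_le_supportDim h2) 1).trans
        (h1.trans ((ringKrullDim_quotient_le_supportDim hp').trans hM))
      rw [← hdimA, heq] at h3
      exact absurd (ENat.WithBot.add_one_le_natCast_iff.1 h3) (lt_irrefl _)
    have hass : p.asIdeal ∈ associatedPrimes R M := by
      refine Module.associatedPrimes.minimalPrimes_annihilator_subset_associatedPrimes R M
        ⟨⟨p.2, Module.annihilator_le_of_mem_support hp⟩, fun q' hq' hle' ↦ ?_⟩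
      have h1 := hmin ⟨q', hq'.1⟩ (by rw [Module.support_eq_zeroLocus]; exact hq'.2) hle'
      rw [← h1]
    have hrad := hcon _ hass (fun q' hq' hle ↦
      congrArg PrimeSpectrum.asIdeal (hmin ⟨q', hq'.isPrime⟩ (by
        rw [Module.support_eq_zeroLocus]
        exact Submodule.annihilator_top.symm.trans_le hq'.annihilator_le) hle))
    have hdual := isDualFinite_of_supportDim_le I he hme hsoc c A hle
    by_cases htop : I ⊔ p.asIdeal = ⊤
    · obtain ⟨a, ha, b, hb, hab⟩ := Submodule.mem_sup.1 ((Ideal.eq_top_iff_one _).1 htop)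
      refine subsingleton_of_forall_eq 0 fun t ↦ ?_
      have h1 : ∀ n, a ^ n • t = t := fun n ↦ by
        induction n with
        | zero => rw [pow_zero, one_smul]
        | succ n ih =>
          have h2 : (a + b) • t = t := by rw [hab, one_smul]
          rw [add_smul, smul_eq_zero_of_equiv_quotient f hb, add_zero] at h2
          rw [pow_succ, mul_smul, h2, ih]
      obtain ⟨n, hn⟩ := exists_pow_smul_eq_zero_of_mem I c ha t
      rw [← h1 n, hn]
    obtain ⟨P, hP, hleP, hPm⟩ : ∃ P : Ideal R, P.IsPrime ∧ I ⊔ p.asIdeal ≤ P ∧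
        P ≠ maximalIdeal R := by
      by_contra! hall
      refine hrad (le_antisymm ?_ ?_)
      · refine (hall _ (maximalIdeal.isMaximal R).isPrime (le_maximalIdeal htop) ▸ ?_)
        exact (Ideal.radical_mono (le_maximalIdeal htop)).trans
          (maximalIdeal.isMaximal R).isPrime.isRadical
      · rw [Ideal.radical_eq_sInf]
        exact le_sInf fun P hP ↦ (hall P hP.2 hP.1).ge
    obtain ⟨s, hsP, hs⟩ := hdual.exists_smul P hP (le_sup_left.trans hleP) hPm
    have hsp : s ∉ p.asIdeal := fun h ↦ hsP (hleP (le_sup_right (α := Ideal R) h))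
    have hsub : Subsingleton (LC I c (QuotSMulTop s A)) := by
      refine subsingleton_of_supportDim_lt I c _ ?_
      have h1 := Module.supportDim_quotSMulTop_lt f hsp
      rw [heq] at h1
      exact ENat.WithBot.add_one_le_natCast_iff.1 h1
    refine subsingleton_of_forall_eq 0 fun t ↦ ?_
    obtain ⟨t', rfl⟩ := smul_surjective_of_subsingleton I c (isSMulRegular_of_equiv_quotient f hsp)
      hsub t
    exact hs t'
  · intro A B C _ _ _ _ _ _ f g hf hfg hg hA hC
    exact subsingleton_of_exact I _ hf hfg hg hA hC

end LocalCohomologyAux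

section Dimension

open IsLocalRing

open TensorProduct

lemma Module.supportDim_le_of_forall {R : Type} [CommRing R] {M : Type} [AddCommGroup M]
    [Module R M] {k : WithBot ℕ∞}
    (h : ∀ p ∈ Module.support R M, ringKrullDim (R ⧸ p.asIdeal) ≤ k) :
    Module.supportDim R M ≤ k := by
  refine iSup_le fun s ↦ ?_
  refine le_trans ?_ (h s.head.1 s.head.2)
  rw [← Module.supportDim_quotient_eq_ringKrullDim]
  let s' : LTSeries (Module.support R (R ⧸ s.head.1.asIdeal)) :=
    { length := s.length
      toFun := fun i ↦ ⟨(s i).1, by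
        rw [Module.support_eq_zeroLocus, Ideal.annihilator_quotient]
        exact s.head_le i⟩
      step := fun i ↦ s.step i }
  exact Order.LTSeries.length_le_krullDim s'

lemma ringKrullDim_quotient_le_zero {R : Type} [CommRing R] [IsLocalRing R] {p : PrimeSpectrum R}
    (hp : maximalIdeal R ≤ p.asIdeal) : ringKrullDim (R ⧸ p.asIdeal) ≤ 0 := by
  have h : p.asIdeal = maximalIdeal R := le_antisymm (le_maximalIdeal p.2.ne_top) hp
  have : p.asIdeal.IsMaximal := h ▸ maximalIdeal.isMaximal R
  let := Ideal.Quotient.field p.asIdeal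
  exact (ringKrullDim_eq_zero_of_field (R ⧸ p.asIdeal)).le

variable {A S : Type} [CommRing A] [CommRing S] [Algebra A S] [IsLocalRing A] [IsLocalRing S]
  [IsNoetherianRing A] [IsNoetherianRing S]

/-- Base change along a local homomorphism with trivial closed fibre does not raise dimension. -/
theorem Module.supportDim_baseChange_le [Module.Flat A S]
    (hAS : (maximalIdeal A).map (algebraMap A S) = maximalIdeal S) (k : ℕ) :
    ∀ (N : Type) [AddCommGroup N] [Module A N] [Module.Finite A N], Module.supportDim A N ≤ k →
      Module.supportDim S (S ⊗[A] N) ≤ k := by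
  induction k using Nat.strong_induction_on with
  | _ k ih =>
  intro N _ _ _ hN
  refine Module.prime_filtration_induction
    {p : PrimeSpectrum A | ringKrullDim (A ⧸ p.asIdeal) ≤ k}
    (fun N _ _ ↦ Module.supportDim S (S ⊗[A] N) ≤ k) ?_ ?_ ?_ N ?_
  · intro N _ _ _
    rw [(Module.supportDim_eq_bot_iff_subsingleton S _).2 inferInstance]
    exact bot_le
  · intro N _ _ p hp e
    have : Module.Finite A N := Module.Finite.equiv e.symm
    by_cases hpm : maximalIdeal A ≤ p.asIdeal
    · refine Module.supportDim_le_of_forall fun P hP ↦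
        (ringKrullDim_quotient_le_zero ?_).trans (by exact_mod_cast Nat.zero_le k)
      rw [← hAS, Ideal.map_le_iff_le_comap]
      intro a ha
      refine Module.annihilator_le_of_mem_support hP (Module.mem_annihilator.2 fun y ↦ ?_)
      have haN : ∀ y : N, a • y = 0 := fun y ↦ by
        apply e.injective
        obtain ⟨r, hr⟩ := Ideal.Quotient.mk_surjective (e y)
        rw [map_smul, map_zero, ← hr, ← Ideal.Quotient.mk_eq_mk, ← Submodule.Quotient.mk_smul,
          Submodule.Quotient.mk_eq_zero]
        exact Ideal.mul_mem_right _ _ (hpm ha)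
      induction y with
      | zero => rw [smul_zero]
      | tmul s y => rw [algebraMap_smul, ← TensorProduct.tmul_smul, haN, TensorProduct.tmul_zero]
      | add y z hy hz => rw [smul_add, hy, hz, add_zero]
    · obtain _ | k := k
      · exact absurd (LocalCohomologyAux.asIdeal_eq_maximalIdeal_of_ringKrullDim_le_zero hp).ge hpm
      obtain ⟨x, hxm, hxp⟩ := SetLike.not_le_iff_exists.1 hpm
      have h1 := Module.supportDim_quotSMulTop_lt e hxp
      rw [Module.supportDim_eq_of_equiv e, Module.supportDim_quotient_eq_ringKrullDim] at h1
      have h2 := h1.trans hp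
      push_cast at h2 ⊢
      have h3 := ih k k.lt_succ_self (QuotSMulTop x N) (ENat.WithBot.add_le_add_one_right_iff.1 h2)
      rw [← Module.supportDim_eq_of_equiv
        (QuotSMulTop.algebraMapTensorEquivTensorQuotSMulTop x N S)] at h3
      refine (Module.supportDim_le_supportDim_quotSMulTop_succ (x := algebraMap A S x)
        (hAS ▸ Ideal.mem_map_of_mem _ hxm)).trans ?_
      exact add_le_add_left h3 1
  · intro X Y Z _ _ _ _ _ _ f g hf hfg hg hX hZ
    refine Module.supportDim_le_of_forall fun P hP ↦ ?_
    have hex : Function.Exact (f.baseChange S) (g.baseChange S) := lTensor_exact S hfg hg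
    rcases Module.support_subset_union_of_exact hex hP with h | h
    · exact (ringKrullDim_quotient_le_supportDim h).trans hX
    · exact (ringKrullDim_quotient_le_supportDim h).trans hZ
  · intro p hp
    exact (ringKrullDim_quotient_le_supportDim hp).trans hN

/-- The dimension drops on localizing a module over a local ring at a nonmaximal prime. -/
theorem Module.supportDim_localizedModule_le {R : Type} [CommRing R] [IsLocalRing R]
    {N : Type} [AddCommGroup N] [Module R N] [Module.Finite R N] (p : Ideal R) [p.IsPrime]
    (hp : p ≠ maximalIdeal R) {k : ℕ} (hN : Module.supportDim R N ≤ (k + 1 : ℕ)) :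
    Module.supportDim (Localization.AtPrime p) (LocalizedModule p.primeCompl N) ≤ k := by
  refine iSup_le fun s ↦ ?_
  let φ := PrimeSpectrum.comap (algebraMap R (Localization.AtPrime p))
  have hmem : ∀ Q ∈ Module.support (Localization.AtPrime p) (LocalizedModule p.primeCompl N),
      φ Q ∈ Module.support R N := by
    intro Q hQ
    rw [Module.support_eq_zeroLocus]
    intro r hr
    refine Module.annihilator_le_of_mem_support hQ (Module.mem_annihilator.2 fun y ↦ ?_)
    rw [algebraMap_smul]
    induction y with
    | _ n t => rw [LocalizedModule.smul'_mk, Module.mem_annihilator.1 hr, LocalizedModule.zero_mk]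
  have hle : ∀ Q, φ Q < closedPoint R := fun Q ↦ by
    have h1 : (φ Q).asIdeal ≤ p := by
      have := Ideal.comap_mono (f := algebraMap R (Localization.AtPrime p))
        (le_maximalIdeal Q.2.ne_top)
      exact this.trans_eq Localization.AtPrime.under_maximalIdeal
    refine lt_of_le_of_ne (le_maximalIdeal (φ Q).2.ne_top) fun h ↦ hp ?_
    rw [h] at h1
    exact le_antisymm (le_maximalIdeal (Ideal.IsPrime.ne_top ‹_›)) h1
  have hmono : ∀ Q Q', Q < Q' → φ Q < φ Q' := fun Q Q' h ↦
    lt_of_le_of_ne (Ideal.comap_mono h.le) fun heq ↦ h.ne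
      (PrimeSpectrum.localization_comap_injective (Localization.AtPrime p) p.primeCompl heq)
  let s' : LTSeries (Module.support R N) :=
    { length := s.length
      toFun := fun i ↦ ⟨φ (s i).1, hmem _ (s i).2⟩
      step := fun i ↦ hmono _ _ (s.step i) }
  let t := s'.snoc ⟨closedPoint R, Module.mem_support_mono (hle s.head.1).le (hmem _ s.head.2)⟩
    (hle s.last.1)
  have h : ((t.length : ℕ) : WithBot ℕ∞) ≤ (k + 1 : ℕ) :=
    (Order.LTSeries.length_le_krullDim t).trans hN
  have h3 : t.length = s.length + 1 := rfl
  rw [h3] at h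
  have h4 : s.length ≤ k := by
    have : s.length + 1 ≤ k + 1 := by exact_mod_cast h
    omega
  exact_mod_cast h4

end Dimension

section Main

open TensorProduct IsLocalRing

namespace LocalCohomologyAux

/-- The completed localization of a finite module as a base change of the module. -/
noncomputable def completionLocalizationEquiv {R : Type} [CommRing R] [IsNoetherianRing R]
    (p : Ideal R) [p.IsPrime] (N : Type) [AddCommGroup N] [Module R N] [Module.Finite R N] :
    AdicCompletion (maximalIdeal (Localization.AtPrime p)) (LocalizedModule p.primeCompl N)
      ≃ₗ[AdicCompletion (maximalIdeal (Localization.AtPrime p)) (Localization.AtPrime p)]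
    AdicCompletion (maximalIdeal (Localization.AtPrime p)) (Localization.AtPrime p)
      ⊗[Localization.AtPrime p] LocalizedModule p.primeCompl N :=
  (AdicCompletion.ofTensorProductEquivOfFiniteNoetherian
    (maximalIdeal (Localization.AtPrime p)) (LocalizedModule p.primeCompl N)).symm

/-- Base change of a localized module is base change of the module. -/
noncomputable def tensorLocalizedEquiv {R : Type} [CommRing R]
    (p : Ideal R) [p.IsPrime] (S : Type) [CommRing S] [Algebra R S]
    [Algebra (Localization.AtPrime p) S] [IsScalarTower R (Localization.AtPrime p) S]
    (N : Type) [AddCommGroup N] [Module R N] :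
    S ⊗[Localization.AtPrime p] LocalizedModule p.primeCompl N ≃ₗ[S] S ⊗[R] N :=
  (TensorProduct.AlgebraTensorModule.congr (LinearEquiv.refl S S)
    (LocalizedModule.equivTensorProduct p.primeCompl N)).trans
    (TensorProduct.AlgebraTensorModule.cancelBaseChange R (Localization.AtPrime p) S S N)

end LocalCohomologyAux

open LocalCohomologyAux

theorem isQuintasymptotic_of_mem_support {R : Type} [CommRing R] [IsLocalRing R]
    [IsNoetherianRing R] {N : Type} [AddCommGroup N] [Module R N] [Module.Finite R N]
    {I : Ideal R} {k : ℕ} (hN : Module.supportDim R N ≤ (k + 1 : ℕ)) {p : PrimeSpectrum R}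
    (hp : p ∈ Module.support R (LC I k N)) (hpm : p.asIdeal ≠ maximalIdeal R) :
    I.IsQuintasymptotic p.asIdeal N := by
  refine ⟨p.2, ?_⟩
  unfold Ideal.quintAux
  rw [← IsScalarTower.algebraMap_eq]
  let A := Localization.AtPrime p.asIdeal
  let S := AdicCompletion (maximalIdeal A) A
  have : IsNoetherianRing S := AdicCompletion.isNoetherianRing _
  have : Module.FaithfullyFlat A S := Module.FaithfullyFlat.of_flat_of_isLocalHom
  have : Module.Flat R S := Module.Flat.trans R A S
  have hAS : (maximalIdeal A).map (algebraMap A S) = maximalIdeal S :=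
    AdicCompletion.maximalIdeal_eq_map.symm
  have e := completionLocalizationEquiv p.asIdeal N
  have e' := e.trans (tensorLocalizedEquiv p.asIdeal S N)
  have : Module.Finite S
      (AdicCompletion (maximalIdeal A) (LocalizedModule p.asIdeal.primeCompl N)) :=
    Module.Finite.equiv e.symm
  have hdim : Module.supportDim S
      (AdicCompletion (maximalIdeal A) (LocalizedModule p.asIdeal.primeCompl N)) ≤ k := by
    rw [Module.supportDim_eq_of_equiv e]
    exact Module.supportDim_baseChange_le hAS k _
      (Module.supportDim_localizedModule_le p.asIdeal hpm hN)
  have hne : ¬ Subsingleton (LC (I.map (algebraMap R S)) k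
      (AdicCompletion (maximalIdeal A) (LocalizedModule p.asIdeal.primeCompl N))) := by
    intro h
    have : Subsingleton (LC (I.map (algebraMap R S)) k (S ⊗[R] N)) :=
      (congr (I.map (algebraMap R S)) k e').symm.toEquiv.subsingleton
    have h1 : Subsingleton (S ⊗[R] LC I k N) := subsingleton_tensorProduct I k N
    have : Nontrivial (LocalizedModule p.asIdeal.primeCompl (LC I k N)) := hp
    have h2 : Nontrivial (S ⊗[A] LocalizedModule p.asIdeal.primeCompl (LC I k N)) :=
      Module.FaithfullyFlat.lTensor_nontrivial _ _ _
    have h3 := (tensorLocalizedEquiv p.asIdeal S (LC I k N)).toEquiv.subsingleton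
    exact not_subsingleton _ h3
  obtain ⟨q, hq, hmin, hrad⟩ := exists_radical_sup_eq_maximalIdeal (I.map (algebraMap R S)) k _
    hdim hne
  refine ⟨q, ⟨hq, fun q' hq' hle ↦ (hmin q' hq' hle).ge⟩, hrad.trans ?_⟩
  rw [IsScalarTower.algebraMap_eq R A S, ← Ideal.map_map,
    Localization.AtPrime.map_eq_maximalIdeal, hAS]

end Main

/-- For a Noetherian local ring `(R, 𝔪)` and `N` finitely generated of dimension `d`,
`Supp(H^{d-1}_I(N)) ⊆ Q̄*(I, N) ∪ {𝔪}`; consequently `Ass_R H^{d-1}_I(N)` is finite. -/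
theorem support_localCohomology_pred_subset_quintasymptotic {R : Type} [CommRing R]
    [IsLocalRing R] [IsNoetherianRing R] (N : Type) [AddCommGroup N] [Module R N]
    [Module.Finite R N] (d : ℕ)
    (hd : Order.krullDim (Module.support R N) = (d : WithBot (WithTop ℕ))) (I : Ideal R) :
    Module.support R ((localCohomology I (d - 1)).obj (ModuleCat.of R N)) ⊆
      {p : PrimeSpectrum R | Ideal.IsQuintasymptotic I p.asIdeal N ∨
        p.asIdeal = IsLocalRing.maximalIdeal R} ∧
    (associatedPrimes R ((localCohomology I (d - 1)).obj (ModuleCat.of R N))).Finite := by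
  have hd' : Module.supportDim R N = (d : WithBot ℕ∞) := hd
  have hN : Module.supportDim R N ≤ (d - 1 + 1 : ℕ) := by
    rw [hd']
    exact_mod_cast (by omega : d ≤ d - 1 + 1)
  refine ⟨fun p hp ↦ ?_, ?_⟩
  · by_cases hpm : p.asIdeal = IsLocalRing.maximalIdeal R
    · exact Or.inr hpm
    · exact Or.inl (isQuintasymptotic_of_mem_support hN hp hpm)
  · refine ((LocalCohomologyAux.support_finite I (d - 1) N hN).image
      PrimeSpectrum.asIdeal).subset ?_
    intro P hP
    obtain ⟨m, hm⟩ := ((isAssociatedPrime_iff_exists_injective_linearMap P _).1 hP).2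
    exact ⟨⟨P, hP.isPrime⟩, Module.support_subset_of_injective m hm (by
      rw [Module.support_eq_zeroLocus, Ideal.annihilator_quotient]
      exact le_refl P), rfl⟩
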